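/- Assume the ABC conjecture. Then there exists D such that M(d) ≤ 9 for every integer d ≥ D. -/

import Mathlib

/-- The ABC conjecture: for every `ε > 0` there is `K > 0` such that for all
nonzero integers `A, B, C` with `A + B = C` and `gcd(A, B) = 1`,
`max(|A|,|B|,|C|) ≤ K * rad(|ABC|)^(1+ε)`, where `rad` is the product of the
distinct primes dividing the number. -/
def ABCConjecture : Prop :=
  ∀ ε : ℝ, 0 < ε → ∃ K : ℝ, 0 < K ∧ ∀ A B C : ℤ,
    A ≠ 0 → B ≠ 0 → C ≠ 0 → A + B = C → Int.gcd A B = 1 →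
    ((max (max |A| |B|) |C| : ℤ) : ℝ) ≤
      K * ((∏ p ∈ (A * B * C).natAbs.primeFactors, p : ℕ) : ℝ) ^ (1 + ε)

/-- A pair of integers `(a, b)` is multiplicatively dependent: `ab ≠ 0` and
there is a nonzero pair of integer exponents `(k₁, k₂)` with `a^k₁ * b^k₂ = 1`
(evaluated in `ℚ`). -/
def MultDepPair (a b : ℤ) : Prop :=
  a * b ≠ 0 ∧ ∃ k : ℤ × ℤ, k ≠ 0 ∧ (a : ℚ) ^ k.1 * (b : ℚ) ^ k.2 = 1

/-- `MSet d` is the set of multiplicatively dependent pairs `(a, b) ∈ ℤ²`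
with difference `b - a = d`. -/
def MSet (d : ℤ) : Set (ℤ × ℤ) :=
  {p | MultDepPair p.1 p.2 ∧ p.2 - p.1 = d}

/-- `M d` is the number of multiplicatively dependent pairs with difference `d`. -/
noncomputable def M (d : ℤ) : ℕ := (MSet d).ncard

/-- `g` is a perfect power: `g = a ^ k` with `a ≥ 2`, `k ≥ 2`. -/
def IsPerfectPow (g : ℕ) : Prop := ∃ a k : ℕ, 2 ≤ a ∧ 2 ≤ k ∧ g = a ^ k

/-- `Nplus d` is the number of primitive solutions `(g, x, y)` of `g^y + g^x = d`
with `g ≥ 2` not a perfect power and `y > x ≥ 1`. -/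
noncomputable def Nplus (d : ℕ) : ℕ :=
  {T : ℕ × ℕ × ℕ | 2 ≤ T.1 ∧ 1 ≤ T.2.1 ∧ T.2.1 < T.2.2 ∧ ¬ IsPerfectPow T.1 ∧
    T.1 ^ T.2.2 + T.1 ^ T.2.1 = d}.ncard

/-- `Nminus d` is the number of primitive solutions `(g, x, y)` of `g^y - g^x = d`
with `g ≥ 2` not a perfect power and `y > x ≥ 1`. -/
noncomputable def Nminus (d : ℕ) : ℕ :=
  {T : ℕ × ℕ × ℕ | 2 ≤ T.1 ∧ 1 ≤ T.2.1 ∧ T.2.1 < T.2.2 ∧ ¬ IsPerfectPow T.1 ∧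
    T.1 ^ T.2.2 = T.1 ^ T.2.1 + d}.ncard

/-- The product of the distinct primes dividing `n`. -/
def rad (n : ℕ) : ℕ := ∏ p ∈ n.primeFactors, p

lemma rad_pos (n : ℕ) : 0 < rad n :=
  Finset.prod_pos fun _ hp => (Nat.prime_of_mem_primeFactors hp).pos

lemma rad_le {n : ℕ} (hn : n ≠ 0) : rad n ≤ n :=
  Nat.le_of_dvd (Nat.pos_of_ne_zero hn) (Nat.prod_primeFactors_dvd n)

lemma rad_mul_le (m n : ℕ) : rad (m * n) ≤ rad m * rad n := by
  rcases eq_or_ne m 0 with rfl | hm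
  · simpa [rad] using Nat.succ_le_of_lt (rad_pos n)
  rcases eq_or_ne n 0 with rfl | hn
  · simpa [rad] using Nat.succ_le_of_lt (rad_pos m)
  unfold rad
  rw [Nat.primeFactors_mul hm hn, ← Finset.prod_union_inter]
  exact Nat.le_mul_of_pos_right _
    (Finset.prod_pos fun p hp => (Nat.prime_of_mem_primeFactors (Finset.mem_inter.1 hp).1).pos)

lemma rad_pow_le (n k : ℕ) : rad (n ^ k) ≤ rad n := by
  rcases Nat.eq_zero_or_pos k with rfl | hk
  · simpa [rad] using Nat.succ_le_of_lt (rad_pos n)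
  · simp [rad, Nat.primeFactors_pow n hk.ne']

lemma rad_le_of_dvd {m n : ℕ} (hn : n ≠ 0) (h : m ∣ n) : rad m ≤ rad n :=
  Nat.le_of_dvd (rad_pos n)
    (Finset.prod_dvd_prod_of_subset _ _ _ (Nat.primeFactors_mono h hn))

/-- The logarithm of the radical of an integer. -/
noncomputable def lrad (n : ℤ) : ℝ := Real.log (rad n.natAbs)

lemma lrad_nonneg (n : ℤ) : 0 ≤ lrad n := Real.log_natCast_nonneg _

lemma lrad_mul_le (m n : ℤ) : lrad (m * n) ≤ lrad m + lrad n := by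
  unfold lrad
  have h1 : (0 : ℝ) < rad m.natAbs := by exact_mod_cast rad_pos _
  have h2 : (0 : ℝ) < rad n.natAbs := by exact_mod_cast rad_pos _
  rw [← Real.log_mul h1.ne' h2.ne', Int.natAbs_mul]
  refine Real.log_le_log (by exact_mod_cast rad_pos _) ?_
  exact_mod_cast rad_mul_le _ _

lemma lrad_pow_le (n : ℤ) (k : ℕ) : lrad (n ^ k) ≤ lrad n := by
  unfold lrad
  rw [Int.natAbs_pow]
  exact Real.log_le_log (by exact_mod_cast rad_pos _) (by exact_mod_cast rad_pow_le _ _)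

lemma log_natAbs (n : ℤ) : Real.log (n.natAbs : ℝ) = Real.log (n : ℝ) := by
  rw [Nat.cast_natAbs, Int.cast_abs, Real.log_abs]

lemma lrad_le {n : ℤ} (hn : n ≠ 0) : lrad n ≤ Real.log n := by
  rw [← log_natAbs]
  exact Real.log_le_log (by exact_mod_cast rad_pos _)
    (by exact_mod_cast rad_le (Int.natAbs_ne_zero.2 hn))

lemma lrad_le_of_dvd {m n : ℤ} (hn : n ≠ 0) (h : m ∣ n) : lrad m ≤ lrad n :=
  Real.log_le_log (by exact_mod_cast rad_pos _) (by
    exact_mod_cast rad_le_of_dvd (Int.natAbs_ne_zero.2 hn) (Int.natAbs_dvd_natAbs.2 h))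

lemma log_int_nonneg (n : ℤ) : 0 ≤ Real.log (n : ℝ) := by
  rw [← log_natAbs]; exact Real.log_natCast_nonneg _

/-- A square factor makes the radical small. -/
lemma lrad_le_sub_of_sq_dvd {u n : ℤ} (hn : n ≠ 0) (h : u ^ 2 ∣ n) :
    lrad n ≤ lrad u + Real.log n - 2 * Real.log u := by
  obtain ⟨v, rfl⟩ := h
  have hu : u ≠ 0 := by rintro rfl; simp at hn
  have hv : v ≠ 0 := by rintro rfl; simp at hn
  have h1 := lrad_mul_le (u ^ 2) v
  have h2 := lrad_pow_le u 2
  have h3 := lrad_le hv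
  push_cast
  rw [Real.log_mul (by exact_mod_cast pow_ne_zero 2 hu) (by exact_mod_cast hv), Real.log_pow]
  push_cast
  linarith

/-- Logarithmic form of the ABC conjecture. -/
lemma ABCConjecture.log_le (habc : ABCConjecture) {ε : ℝ} (hε : 0 < ε) :
    ∃ κ : ℝ, 0 ≤ κ ∧ ∀ A B C : ℤ, A ≠ 0 → B ≠ 0 → C ≠ 0 → A + B = C → Int.gcd A B = 1 →
      Real.log A ≤ κ + (1 + ε) * lrad (A * B * C) := by
  obtain ⟨K, hK, h⟩ := habc ε hε
  refine ⟨max (Real.log K) 0, le_max_right _ _, fun A B C hA hB hC hABC hg => ?_⟩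
  have h1 := h A B C hA hB hC hABC hg
  have hr : (0 : ℝ) < rad (A * B * C).natAbs := by exact_mod_cast rad_pos _
  have h2 : |(A : ℝ)| ≤ K * (rad (A * B * C).natAbs : ℝ) ^ (1 + ε) := by
    refine le_trans ?_ h1
    exact_mod_cast (le_max_left _ _).trans (le_max_left _ _)
  have h3 := Real.log_le_log (by positivity) h2
  rw [Real.log_abs, Real.log_mul hK.ne' (by positivity), Real.log_rpow hr] at h3
  exact h3.trans (add_le_add (le_max_left _ _) le_rfl)

lemma exists_coprime_triple {A B C : ℤ} (hA : A ≠ 0) (hABC : A + B = C) :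
    ∃ (G : ℕ) (A' B' C' : ℤ), G ≠ 0 ∧ A = G * A' ∧ B = G * B' ∧ C = G * C' ∧ A' + B' = C' ∧
      Int.gcd A' B' = 1 := by
  have hG : 0 < Int.gcd A B := Int.gcd_pos_of_ne_zero_left _ hA
  obtain ⟨A', hA'⟩ := Int.gcd_dvd_left A B
  obtain ⟨B', hB'⟩ := Int.gcd_dvd_right A B
  have hz : (Int.gcd A B : ℤ) ≠ 0 := by exact_mod_cast hG.ne'
  refine ⟨Int.gcd A B, A', B', A' + B', hG.ne', hA', hB', ?_, rfl, ?_⟩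
  · rw [← hABC, mul_add, ← hA', ← hB']
  · have := Int.gcd_div_gcd_div_gcd hG
    rwa [Int.ediv_eq_of_eq_mul_right hz hA', Int.ediv_eq_of_eq_mul_right hz hB'] at this

lemma lrad_mul_three_le (A B C : ℤ) : lrad (A * B * C) ≤ lrad A + lrad B + lrad C :=
  (lrad_mul_le _ _).trans (add_le_add (lrad_mul_le _ _) le_rfl)

/-- ABC for triples that need not be coprime, with a loss of the size of the second term. -/
lemma ABCConjecture.log_le_add_lrad (habc : ABCConjecture) {ε : ℝ} (hε : 0 < ε) :
    ∃ κ : ℝ, 0 ≤ κ ∧ ∀ A B C : ℤ, A ≠ 0 → B ≠ 0 → C ≠ 0 → A + B = C →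
      Real.log A ≤ Real.log B + κ + (1 + ε) * (lrad A + lrad B + lrad C) := by
  obtain ⟨κ, hκ, h⟩ := habc.log_le hε
  refine ⟨κ, hκ, fun A B C hA hB hC hABC => ?_⟩
  obtain ⟨G, A', B', C', hG, rfl, rfl, rfl, h1, h2⟩ := exists_coprime_triple hA hABC
  have hA' := right_ne_zero_of_mul hA
  have hB' := right_ne_zero_of_mul hB
  have hC' := right_ne_zero_of_mul hC
  have h3 := h A' B' C' hA' hB' hC' h1 h2
  have h4 := lrad_mul_three_le A' B' C'
  have h5 := lrad_le_of_dvd hA (Dvd.intro_left _ rfl)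
  have h6 := lrad_le_of_dvd hB (Dvd.intro_left _ rfl)
  have h7 := lrad_le_of_dvd hC (Dvd.intro_left _ rfl)
  have h8 := log_int_nonneg B'
  have h9 : (1 + ε) * lrad (A' * B' * C') ≤
      (1 + ε) * (lrad (G * A') + lrad (G * B') + lrad (G * C')) :=
    mul_le_mul_of_nonneg_left (by linarith) (by linarith)
  rw [Int.cast_mul, Int.cast_mul, Int.cast_natCast,
    Real.log_mul (by exact_mod_cast hG) (by exact_mod_cast hA'),
    Real.log_mul (by exact_mod_cast hG) (by exact_mod_cast hB')]
  linarith

open Polynomial in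
lemma Polynomial.sq_dvd_eval {f : ℤ[X]} {a : ℤ} (h0 : f.eval a = 0)
    (h1 : f.derivative.eval a = 0) (z : ℤ) : (z - a) ^ 2 ∣ f.eval z := by
  obtain ⟨k, hk⟩ := f.binomExpansion a (z - a)
  rw [add_sub_cancel, h0, h1] at hk
  rw [hk]
  exact ⟨k, by ring⟩

open Polynomial in
/-- `z = p` is a critical point of `z ^ p * (p + q - z) ^ q`. -/
lemma sq_dvd_pow_mul_sub_pow (p q : ℕ) (hp : 1 ≤ p) (hq : 1 ≤ q) (z : ℤ) :
    (z - p) ^ 2 ∣ z ^ p * ((p : ℤ) + q - z) ^ q - (p : ℤ) ^ p * (q : ℤ) ^ q := by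
  obtain ⟨p, rfl⟩ := Nat.exists_eq_add_of_le' hp
  obtain ⟨q, rfl⟩ := Nat.exists_eq_add_of_le' hq
  have h := Polynomial.sq_dvd_eval (f := X ^ (p + 1) * (C (((p + 1 : ℕ) : ℤ) + (q + 1 : ℕ)) - X) ^ (q + 1)
    - C (((p + 1 : ℕ) : ℤ) ^ (p + 1) * ((q + 1 : ℕ) : ℤ) ^ (q + 1))) (a := (p + 1 : ℕ))
    (by simp) (by
      simp only [derivative_sub, derivative_mul, derivative_pow, derivative_C,
        derivative_X]
      simp
      ring) z
  simpa using h

open Polynomial in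
/-- `z = -σ x` is a critical point of `z ^ x * (z + σ (x + k)) ^ k`. -/
lemma sq_dvd_pow_mul_add_pow (x k : ℕ) (hx : 1 ≤ x) (hk : 1 ≤ k) (σ z : ℤ) :
    (z + σ * x) ^ 2 ∣ z ^ x * (z + σ * (x + k)) ^ k - (-σ * x) ^ x * (σ * k) ^ k := by
  obtain ⟨x, rfl⟩ := Nat.exists_eq_add_of_le' hx
  obtain ⟨k, rfl⟩ := Nat.exists_eq_add_of_le' hk
  have h := Polynomial.sq_dvd_eval (f := X ^ (x + 1) * (X + C (σ * ((x + 1 : ℕ) + (k + 1 : ℕ)))) ^ (k + 1)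
    - C ((-σ * (x + 1 : ℕ)) ^ (x + 1) * (σ * (k + 1 : ℕ)) ^ (k + 1))) (a := -σ * (x + 1 : ℕ))
    (by simp; rw [sub_eq_zero]; congr 2; ring) (by
      simp only [derivative_sub, derivative_mul, derivative_pow, derivative_C,
        derivative_X, derivative_add]
      simp
      ring) z
  simpa using h

lemma lrad_neg (n : ℤ) : lrad (-n) = lrad n := by simp [lrad]

/-- Combining ABC with the Belyi map `z ^ p * (p + q - z) ^ q`. -/
lemma ABCConjecture.two_log_le (habc : ABCConjecture) (p q : ℕ) (hp : 1 ≤ p) (hq : 1 ≤ q)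
    {ε : ℝ} (hε : 0 < ε) :
    ∃ κ : ℝ, 0 ≤ κ ∧ ∀ X : ℤ, 2 * ((p : ℤ) + q) + 1 ≤ X →
      2 * Real.log X ≤ κ + lrad X + lrad (X - (p + q : ℕ)) + lrad (X - p) + ε * Real.log X := by
  have hN : (0 : ℝ) < p + q + 1 := by positivity
  obtain ⟨κ, hκ, h⟩ := habc.log_le_add_lrad (ε := ε / (p + q + 1)) (by positivity)
  set δ := ε / (p + q + 1 : ℝ) with hδ
  have hδ0 : 0 < δ := by positivity
  set c : ℤ := (p : ℤ) ^ p * (q : ℤ) ^ q with hc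
  have hp' : (1 : ℤ) ≤ p := by exact_mod_cast hp
  have hq' : (1 : ℤ) ≤ q := by exact_mod_cast hq
  have hc0 : 1 ≤ c := by
    have := one_le_pow₀ hp' (n := p)
    have := one_le_pow₀ hq' (n := q)
    nlinarith
  refine ⟨κ + q * Real.log 2 + Real.log c + (1 + δ) * (lrad c + Real.log 2 + 2 * Real.log 2), ?_, ?_⟩
  · have := lrad_nonneg c
    have := log_int_nonneg c
    have := Real.log_pos one_lt_two
    positivity
  intro X hX
  have hX0 : 0 < X := by omega
  have hX1 : 0 < X - p := by omega
  have hX2 : 0 < X - (p + q : ℕ) := by push_cast; omega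
  set A : ℤ := X ^ p * ((p : ℤ) + q - X) ^ q with hA
  have hAabs : |A| = X ^ p * (X - (p + q : ℕ)) ^ q := by
    rw [hA, abs_mul, abs_pow, abs_pow, abs_of_pos hX0, abs_sub_comm, abs_of_pos] <;>
      push_cast <;> [rfl; omega]
  have hcA : c < |A| := by
    rw [hAabs, hc]
    have h1 : (p : ℤ) ^ p ≤ X ^ p := pow_le_pow_left₀ (by omega) (by omega) _
    have h2 : (q : ℤ) ^ q < (X - (p + q : ℕ)) ^ q :=
      pow_lt_pow_left₀ (by push_cast; omega) (by omega) (by omega)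
    exact mul_lt_mul' h1 h2 (by positivity) (by positivity)
  have hA0 : A ≠ 0 := by intro h0; rw [h0] at hcA; simp at hcA; omega
  have hC0 : A - c ≠ 0 := by
    intro h0
    rw [sub_eq_zero.1 h0, abs_of_pos (by omega)] at hcA
    omega
  have h1 := h A (-c) (A - c) hA0 (by omega) hC0 (by ring)
  have h2 := lrad_le_sub_of_sq_dvd hC0 (sq_dvd_pow_mul_sub_pow p q hp hq X)
  have lX : 0 < Real.log X := Real.log_pos (by exact_mod_cast (by omega : 1 < X))
  have hXr : (0 : ℝ) < X := by exact_mod_cast hX0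
  have l2 := Real.log_pos one_lt_two
  have hlA : Real.log A = p * Real.log X + q * Real.log ((X - (p + q : ℕ) : ℤ) : ℝ) := by
    rw [← Real.log_abs, ← Int.cast_abs, hAabs]
    rw [Int.cast_mul, Int.cast_pow, Int.cast_pow, Real.log_mul, Real.log_pow, Real.log_pow]
    · exact_mod_cast (pow_pos hX0 _).ne'
    · exact_mod_cast (pow_pos hX2 _).ne'
  have half : ∀ Y : ℤ, 0 < Y → X ≤ 2 * Y → Real.log X - Real.log 2 ≤ Real.log Y := by
    intro Y hY hXY
    rw [← Real.log_div hXr.ne' two_ne_zero]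
    refine Real.log_le_log (by positivity) ?_
    rw [div_le_iff₀ two_pos, mul_comm]
    exact_mod_cast hXY
  have hl1 := half _ hX1 (by omega)
  have hl2 := half _ hX2 (by push_cast; omega)
  have hl3 : Real.log ((X - (p + q : ℕ) : ℤ) : ℝ) ≤ Real.log X :=
    Real.log_le_log (by exact_mod_cast hX2) (by exact_mod_cast (by push_cast; omega : X - (p + q : ℕ) ≤ X))
  have hl4 : Real.log ((X - p : ℤ) : ℝ) ≤ Real.log X :=
    Real.log_le_log (by exact_mod_cast hX1) (by exact_mod_cast (by omega : X - p ≤ X))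
  have hC : Real.log ((A - c : ℤ) : ℝ) ≤ Real.log 2 + Real.log A := by
    rw [← Real.log_abs, ← Real.log_abs (A : ℝ), ← Real.log_mul two_ne_zero (by
      simpa using hA0)]
    refine Real.log_le_log (by simpa using (by exact_mod_cast hC0 : ((A - c : ℤ) : ℝ) ≠ 0)) ?_
    have : |A - c| ≤ 2 * |A| := by
      refine (abs_sub _ _).trans ?_
      rw [abs_of_pos (by omega : 0 < c)]
      omega
    exact_mod_cast this
  have hrA : lrad A ≤ lrad X + lrad (X - (p + q : ℕ)) := by
    refine (lrad_mul_le _ _).trans (add_le_add (lrad_pow_le _ _) ((lrad_pow_le _ _).trans ?_))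
    rw [← lrad_neg]
    exact le_of_eq (by congr 1; push_cast; ring)
  have hq2 : (q : ℝ) * (Real.log X - Real.log 2) ≤ q * Real.log ((X - (p + q : ℕ) : ℤ) : ℝ) :=
    mul_le_mul_of_nonneg_left hl2 (by positivity)
  have hq3 : (q : ℝ) * Real.log ((X - (p + q : ℕ) : ℤ) : ℝ) ≤ q * Real.log X :=
    mul_le_mul_of_nonneg_left hl3 (by positivity)
  rw [lrad_neg, Int.cast_neg, Real.log_neg_eq_log] at h1
  have r1 := lrad_le hX0.ne'
  have r2 := (lrad_le hX2.ne').trans hl3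
  have r3 := (lrad_le hX1.ne').trans hl4
  have hCb : lrad (A - c) ≤ lrad (X - p) + 3 * Real.log 2 + (p + q - 2) * Real.log X := by
    linarith
  have e1 : δ * (p + q + 1) = ε := by rw [hδ]; field_simp
  have e2 : δ * (lrad X + lrad (X - (p + q : ℕ)) + lrad (X - p) + (p + q - 2) * Real.log X)
      ≤ δ * ((p + q + 1) * Real.log X) := mul_le_mul_of_nonneg_left (by linarith) hδ0.le
  have e3 : (1 + δ) * (lrad A + lrad c + lrad (A - c)) ≤
      (1 + δ) * (lrad X + lrad (X - (p + q : ℕ)) + lrad c +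
        (lrad (X - p) + 3 * Real.log 2 + (p + q - 2) * Real.log X)) :=
    mul_le_mul_of_nonneg_left (by linarith) (by linarith)
  rw [← mul_assoc, e1] at e2
  linarith

/-- `d = g ^ x * (g ^ k + σ)` with a sign `σ`. -/
structure IsRep (d : ℤ) (g x k : ℕ) (σ : ℤ) : Prop where
  two_le : 2 ≤ g
  one_le_x : 1 ≤ x
  one_le_k : 1 ≤ k
  sign : σ = 1 ∨ σ = -1
  eq : (g : ℤ) ^ x * ((g : ℤ) ^ k + σ) = d

namespace IsRep

variable {d : ℤ} {g x k : ℕ} {σ : ℤ}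

lemma two_le_pow (h : IsRep d g x k σ) {n : ℕ} (hn : 1 ≤ n) : (2 : ℤ) ≤ (g : ℤ) ^ n := by
  have h1 : (2 : ℤ) ≤ g := by exact_mod_cast h.two_le
  exact h1.trans (le_self_pow₀ (by omega) (by omega))

lemma log_pos (h : IsRep d g x k σ) : Real.log 2 ≤ Real.log g :=
  Real.log_le_log two_pos (by exact_mod_cast h.two_le)

lemma add_pos (h : IsRep d g x k σ) : 0 < (g : ℤ) ^ k + σ := by
  have := h.two_le_pow h.one_le_k
  rcases h.sign with h | h <;> omega

lemma pos (h : IsRep d g x k σ) : 0 < d := by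
  rw [← h.eq]
  exact mul_pos (by linarith [h.two_le_pow h.one_le_x]) h.add_pos

lemma abs_log_add (h : IsRep d g x k σ) :
    |Real.log (((g : ℤ) ^ k + σ : ℤ) : ℝ) - k * Real.log g| ≤ Real.log 2 := by
  have h2 := h.two_le_pow h.one_le_k
  have hg : (0 : ℝ) < (g : ℝ) ^ k := by exact_mod_cast (by omega : 0 < (g : ℤ) ^ k)
  have hp : (0 : ℝ) < (((g : ℤ) ^ k + σ : ℤ) : ℝ) := by exact_mod_cast h.add_pos
  rw [← Real.log_pow, abs_le]
  constructor
  · rw [← Real.log_div hp.ne' hg.ne', ← Real.log_inv]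
    refine Real.log_le_log (by positivity) ?_
    rw [le_div_iff₀ hg, inv_mul_le_iff₀ two_pos]
    exact_mod_cast (by rcases h.sign with h | h <;> omega :
      (g : ℤ) ^ k ≤ 2 * ((g : ℤ) ^ k + σ))
  · rw [← Real.log_div hp.ne' hg.ne']
    refine Real.log_le_log (by positivity) ?_
    rw [div_le_iff₀ hg]
    exact_mod_cast (by rcases h.sign with h | h <;> omega :
      (g : ℤ) ^ k + σ ≤ 2 * (g : ℤ) ^ k)

lemma log_eq (h : IsRep d g x k σ) :
    Real.log d = x * Real.log g + Real.log (((g : ℤ) ^ k + σ : ℤ) : ℝ) := by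
  have h2 := h.two_le_pow h.one_le_x
  rw [← h.eq, Int.cast_mul, Real.log_mul, Int.cast_pow, Real.log_pow, Int.cast_natCast]
  · exact_mod_cast (by omega : (g : ℤ) ^ x ≠ 0)
  · exact_mod_cast h.add_pos.ne'

lemma abs_log (h : IsRep d g x k σ) :
    |Real.log d - (x + k) * Real.log g| ≤ Real.log 2 := by
  rw [h.log_eq]
  convert h.abs_log_add using 2
  ring

lemma lrad_le (h : IsRep d g x k σ) : lrad d ≤ Real.log g + Real.log 2 + k * Real.log g := by
  rw [← h.eq]
  have h1 := lrad_mul_le ((g : ℤ) ^ x) ((g : ℤ) ^ k + σ)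
  have h2 := lrad_pow_le (g : ℤ) x
  have h3 := _root_.lrad_le (n := (g : ℤ)) (by have := h.two_le; omega)
  have h4 := _root_.lrad_le h.add_pos.ne'
  have h5 := (abs_le.1 h.abs_log_add).2
  rw [Int.cast_natCast] at h3
  linarith

lemma sq_dvd (h : IsRep d g x k σ) (n : ℕ) :
    (((x : ℤ) + k) * (g : ℤ) ^ k + σ * x) ^ 2 ∣
      (((x : ℤ) + k) ^ (x + k)) ^ (2 * n) * d ^ (2 * (k * n)) -
        ((x : ℤ) ^ x * (k : ℤ) ^ k) ^ (2 * n) := by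
  have h1 := sq_dvd_pow_mul_add_pow x k h.one_le_x h.one_le_k σ (((x : ℤ) + k) * (g : ℤ) ^ k)
  have h2 : (((x : ℤ) + k) * (g : ℤ) ^ k) ^ x * (((x : ℤ) + k) * (g : ℤ) ^ k + σ * (x + k)) ^ k =
      ((x : ℤ) + k) ^ (x + k) * d ^ k := by
    rw [← h.eq, show ((x : ℤ) + k) * (g : ℤ) ^ k + σ * (x + k) = (x + k) * ((g : ℤ) ^ k + σ) by ring,
      mul_pow, mul_pow, mul_pow, pow_add]
    ring
  rw [h2] at h1
  have h3 := h1.trans (sub_dvd_pow_sub_pow _ _ (2 * n))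
  have hσ : σ ^ 2 = 1 := by rcases h.sign with rfl | rfl <;> rfl
  have h4 : ((-σ * x) ^ x * (σ * k) ^ k) ^ 2 = ((x : ℤ) ^ x * (k : ℤ) ^ k) ^ 2 := by
    have e : ∀ a b : ℤ, (a ^ x * b ^ k) ^ 2 = (a ^ 2) ^ x * (b ^ 2) ^ k := fun a b => by
      rw [mul_pow, ← pow_mul, ← pow_mul, mul_comm x, mul_comm k, pow_mul, pow_mul]
    rw [e, e, mul_pow (-σ), mul_pow σ, neg_sq, hσ, one_mul, one_mul]
  rw [pow_mul _ 2 n, pow_mul _ 2 n, h4, ← pow_mul, ← pow_mul, mul_pow, ← pow_mul d] at h3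
  rwa [show 2 * (k * n) = k * (2 * n) by ring]

lemma lrad_le_sub (h : IsRep d g x k σ) (n : ℕ) {c : ℤ}
    (hc : c * ((((x : ℤ) + k) ^ (x + k)) ^ (2 * n) * d ^ (2 * (k * n)) -
      ((x : ℤ) ^ x * (k : ℤ) ^ k) ^ (2 * n)) ≠ 0) :
    lrad (c * ((((x : ℤ) + k) ^ (x + k)) ^ (2 * n) * d ^ (2 * (k * n)) -
      ((x : ℤ) ^ x * (k : ℤ) ^ k) ^ (2 * n))) ≤
    Real.log ((c * ((((x : ℤ) + k) ^ (x + k)) ^ (2 * n) * d ^ (2 * (k * n)) -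
      ((x : ℤ) ^ x * (k : ℤ) ^ k) ^ (2 * n)) : ℤ) : ℝ) - k * Real.log g := by
  have h1 := lrad_le_sub_of_sq_dvd hc ((h.sq_dvd n).mul_left c)
  have hk := h.one_le_k
  have h2 := h.two_le_pow h.one_le_k
  have hu : (g : ℤ) ^ k ≤ ((x : ℤ) + k) * (g : ℤ) ^ k + σ * x := by
    have : (1 : ℤ) ≤ k := by exact_mod_cast hk
    rcases h.sign with rfl | rfl <;> nlinarith
  have h3 := _root_.lrad_le (n := ((x : ℤ) + k) * (g : ℤ) ^ k + σ * x) (by omega)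
  have h4 : k * Real.log g ≤ Real.log ((((x : ℤ) + k) * (g : ℤ) ^ k + σ * x : ℤ) : ℝ) := by
    rw [← Real.log_pow]
    refine Real.log_le_log ?_ (by exact_mod_cast hu)
    exact_mod_cast (by omega : 0 < (g : ℤ) ^ k)
  linarith

end IsRep

lemma strictAntiOn_entropy :
    StrictAntiOn (fun r : ℝ => r * Real.log r - (1 + r) * Real.log (1 + r)) (Set.Ioi 0) := by
  have hd : ∀ r : ℝ, 0 < r → HasDerivAt (fun r : ℝ => r * Real.log r - (1 + r) * Real.log (1 + r))
      (Real.log r - Real.log (1 + r)) r := by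
    intro r hr
    have h1 := (Real.hasDerivAt_mul_log hr.ne')
    have h2 := (Real.hasDerivAt_mul_log (by positivity : 1 + r ≠ 0)).comp r
      ((hasDerivAt_id r).const_add 1)
    exact (h1.sub h2).congr_deriv (by ring)
  refine strictAntiOn_of_deriv_neg (convex_Ioi 0) (fun r hr => (hd r hr).continuousAt.continuousWithinAt) ?_
  intro r hr
  rw [interior_Ioi] at hr
  rw [(hd r hr).deriv, sub_neg]
  exact Real.log_lt_log hr (by linarith)

lemma mul_eq_mul_of_entropy_eq {x₁ k₁ x₂ k₂ : ℕ} (hx₁ : 1 ≤ x₁) (hk₁ : 1 ≤ k₁) (hx₂ : 1 ≤ x₂)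
    (hk₂ : 1 ≤ k₂)
    (h : ((x₁ : ℤ) ^ x₁ * (k₁ : ℤ) ^ k₁) ^ (2 * k₂) * (((x₂ : ℤ) + k₂) ^ (x₂ + k₂)) ^ (2 * k₁) =
      ((x₂ : ℤ) ^ x₂ * (k₂ : ℤ) ^ k₂) ^ (2 * k₁) * (((x₁ : ℤ) + k₁) ^ (x₁ + k₁)) ^ (2 * k₂)) :
    x₁ * k₂ = x₂ * k₁ := by
  have a1 : (0 : ℝ) < x₁ := by exact_mod_cast hx₁
  have a2 : (0 : ℝ) < k₁ := by exact_mod_cast hk₁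
  have a3 : (0 : ℝ) < x₂ := by exact_mod_cast hx₂
  have a4 : (0 : ℝ) < k₂ := by exact_mod_cast hk₂
  have h' : ((x₁ : ℝ) ^ x₁ * (k₁ : ℝ) ^ k₁) ^ (2 * k₂) * (((x₂ : ℝ) + k₂) ^ (x₂ + k₂)) ^ (2 * k₁) =
      ((x₂ : ℝ) ^ x₂ * (k₂ : ℝ) ^ k₂) ^ (2 * k₁) * (((x₁ : ℝ) + k₁) ^ (x₁ + k₁)) ^ (2 * k₂) := by
    exact_mod_cast h
  have hl := congrArg Real.log h'
  rw [Real.log_mul (by positivity) (by positivity), Real.log_mul (by positivity) (by positivity)] at hl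
  simp only [Real.log_pow] at hl
  rw [Real.log_mul (by positivity) (by positivity), Real.log_mul (by positivity) (by positivity)] at hl
  simp only [Real.log_pow] at hl
  have key : ∀ x k : ℝ, 0 < x → 0 < k →
      k * ((x / k) * Real.log (x / k) - (1 + x / k) * Real.log (1 + x / k)) =
      x * Real.log x + k * Real.log k - (x + k) * Real.log (x + k) := by
    intro x k hx hk
    have : 1 + x / k = (x + k) / k := by field_simp; ring
    rw [this, Real.log_div hx.ne' hk.ne', Real.log_div (by positivity) hk.ne']
    field_simp
    ring
  have k1 := key x₁ k₁ a1 a2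
  have k2 := key x₂ k₂ a3 a4
  push_cast at hl
  have heq : (x₁ / k₁ : ℝ) = x₂ / k₂ := by
    refine strictAntiOn_entropy.injOn (Set.mem_Ioi.2 (by positivity)) (Set.mem_Ioi.2 (by positivity)) ?_
    have : (k₁ * k₂ : ℝ) ≠ 0 := by positivity
    refine mul_left_cancel₀ this ?_
    linear_combination (k₂ : ℝ) * k1 - k₁ * k2 + hl / 2
  rw [div_eq_div_iff a2.ne' a4.ne'] at heq
  exact_mod_cast heq

lemma ABCConjecture.two_log_le_of_ne (habc : ABCConjecture) {m₁ m₂ : ℤ} (h₁ : 0 < m₁)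
    (h₂ : 0 < m₂) (hne : m₁ ≠ m₂) {ε : ℝ} (hε : 0 < ε) :
    ∃ κ : ℝ, 0 ≤ κ ∧ ∀ X : ℤ, 2 * (m₁ + m₂) + 1 ≤ X →
      2 * Real.log X ≤ κ + lrad X + lrad (X - m₁) + lrad (X - m₂) + ε * Real.log X := by
  wlog h : m₂ < m₁ generalizing m₁ m₂
  · obtain ⟨κ, hκ, H⟩ := this h₂ h₁ hne.symm (lt_of_le_of_ne (not_lt.1 h) hne)
    exact ⟨κ, hκ, fun X hX => by linarith [H X (by omega)]⟩
  lift m₁ to ℕ using h₁.le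
  lift m₂ to ℕ using h₂.le
  obtain ⟨κ, hκ, H⟩ := habc.two_log_le m₂ (m₁ - m₂) (by omega) (by omega) hε
  refine ⟨κ, hκ, fun X hX => ?_⟩
  have := H X (by omega)
  rwa [Nat.add_sub_cancel' (by omega)] at this

lemma le_of_weighted_bound {y₁ y₂ k l c B w G₁ G₂ : ℝ} (hy₁ : 0 < y₁) (hy₂ : 0 < y₂) (hk : 0 ≤ k)
    (hl : 0 ≤ l) (h : k * G₂ ≤ B + G₁ + w) (hw : y₁ * y₂ * w = l / 2) (h₁ : y₁ * G₁ ≤ l + c)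
    (h₂ : l - c ≤ y₂ * G₂) (hlt : y₂ + 1 ≤ k * y₁) :
    l ≤ 2 * (y₁ * y₂ * B + k * y₁ * c + y₂ * c) := by
  have u1 := mul_le_mul_of_nonneg_left h (mul_pos hy₁ hy₂).le
  have u2 := mul_le_mul_of_nonneg_left h₁ hy₂.le
  have u3 := mul_le_mul_of_nonneg_left h₂ (mul_nonneg hk hy₁.le)
  have u4 := mul_le_mul_of_nonneg_right hlt hl
  linarith

/-- For fixed exponents of different ratio, only finitely many `d` have two representations. -/
theorem ABCConjecture.fixed_exponents (habc : ABCConjecture) {x₁ k₁ x₂ k₂ : ℕ}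
    (hne : x₁ * k₂ ≠ x₂ * k₁) :
    ∃ D : ℝ, ∀ (d : ℤ) (g₁ g₂ : ℕ) (σ₁ σ₂ : ℤ), IsRep d g₁ x₁ k₁ σ₁ → IsRep d g₂ x₂ k₂ σ₂ →
      Real.log d ≤ D := by
  by_cases hpos : 1 ≤ x₁ ∧ 1 ≤ k₁ ∧ 1 ≤ x₂ ∧ 1 ≤ k₂
  swap
  · exact ⟨0, fun d g₁ g₂ σ₁ σ₂ h₁ h₂ =>
      absurd ⟨h₁.one_le_x, h₁.one_le_k, h₂.one_le_x, h₂.one_le_k⟩ hpos⟩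
  obtain ⟨hx₁, hk₁, hx₂, hk₂⟩ := hpos
  have b1 : (1 : ℤ) ≤ x₁ := by exact_mod_cast hx₁
  have b2 : (1 : ℤ) ≤ k₁ := by exact_mod_cast hk₁
  have b3 : (1 : ℤ) ≤ x₂ := by exact_mod_cast hx₂
  have b4 : (1 : ℤ) ≤ k₂ := by exact_mod_cast hk₂
  set Y₁ : ℤ := (((x₁ : ℤ) + k₁) ^ (x₁ + k₁)) ^ (2 * k₂) with hY₁
  set Y₂ : ℤ := (((x₂ : ℤ) + k₂) ^ (x₂ + k₂)) ^ (2 * k₁) with hY₂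
  set M₁ : ℤ := ((x₁ : ℤ) ^ x₁ * (k₁ : ℤ) ^ k₁) ^ (2 * k₂) with hM₁
  set M₂ : ℤ := ((x₂ : ℤ) ^ x₂ * (k₂ : ℤ) ^ k₂) ^ (2 * k₁) with hM₂
  have pY₁ : 0 < Y₁ := by positivity
  have pY₂ : 0 < Y₂ := by positivity
  have pM₁ : 0 < M₁ := by positivity
  have pM₂ : 0 < M₂ := by positivity
  set K : ℝ := 2 * (k₁ * k₂) with hK
  set y₁ : ℝ := x₁ + k₁ with hy₁
  set y₂ : ℝ := x₂ + k₂ with hy₂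
  have c2 : (1 : ℝ) ≤ k₁ := by exact_mod_cast hk₁
  have c4 : (1 : ℝ) ≤ k₂ := by exact_mod_cast hk₂
  have c1 : (1 : ℝ) ≤ x₁ := by exact_mod_cast hx₁
  have c3 : (1 : ℝ) ≤ x₂ := by exact_mod_cast hx₂
  have pK : 0 < K := by positivity
  have py₁ : 0 < y₁ := by positivity
  have py₂ : 0 < y₂ := by positivity
  set ε : ℝ := 1 / (2 * K * (y₁ * y₂)) with hε
  have pε : 0 < ε := by positivity
  obtain ⟨κ, hκ, H⟩ := habc.two_log_le_of_ne (mul_pos pM₁ pY₂) (mul_pos pM₂ pY₁)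
    (fun h => hne (mul_eq_mul_of_entropy_eq hx₁ hk₁ hx₂ hk₂ h)) pε
  set m : ℤ := 2 * (M₁ * Y₂ + M₂ * Y₁) + 1 with hm
  set C : ℝ := Real.log ((Y₁ * Y₂ : ℤ) : ℝ) with hC
  have pC : 0 ≤ C := log_int_nonneg _
  set B : ℝ := κ + C + Real.log 2 + ε * C with hB
  refine ⟨max (Real.log m) (max (2 * (y₁ * y₂ * B + k₂ * y₁ * Real.log 2 + y₂ * Real.log 2))
    (2 * (y₂ * y₁ * B + k₁ * y₂ * Real.log 2 + y₁ * Real.log 2))), fun d g₁ g₂ σ₁ σ₂ h₁ h₂ => ?_⟩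
  have hd := h₁.pos
  by_cases hdm : d < m
  · exact (Real.log_le_log (by exact_mod_cast hd) (by exact_mod_cast hdm.le)).trans (le_max_left _ _)
  refine le_trans ?_ (le_max_right _ _)
  set T : ℤ := d ^ (2 * (k₁ * k₂)) with hT
  have hdT : d ≤ T := le_self_pow₀ (by omega) (by positivity)
  set X : ℤ := Y₁ * Y₂ * T with hX
  have hTX : T ≤ X := le_mul_of_one_le_left (by omega) (by nlinarith)
  have hmX : m ≤ X := by omega
  have h3 := H X hmX
  have e1 : X - M₁ * Y₂ = Y₂ * (Y₁ * T - M₁) := by rw [hX]; ring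
  have e2 : X - M₂ * Y₁ = Y₁ * (Y₂ * d ^ (2 * (k₂ * k₁)) - M₂) := by
    rw [hX, hT, mul_comm k₂]; ring
  have q1 : 0 < M₁ * Y₂ := mul_pos pM₁ pY₂
  have q2 : 0 < M₂ * Y₁ := mul_pos pM₂ pY₁
  have r1 : lrad (X - M₁ * Y₂) ≤ Real.log X - k₁ * Real.log g₁ := by
    have := h₁.lrad_le_sub k₂ (c := Y₂) (by rw [← hY₁, ← hM₁, ← hT, ← e1]; omega)
    rw [← hY₁, ← hM₁, ← hT, ← e1] at this
    refine this.trans (sub_le_sub_right (Real.log_le_log ?_ ?_) _)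
    · exact_mod_cast (by omega : 0 < X - M₁ * Y₂)
    · exact_mod_cast (by omega : X - M₁ * Y₂ ≤ X)
  have r2 : lrad (X - M₂ * Y₁) ≤ Real.log X - k₂ * Real.log g₂ := by
    have := h₂.lrad_le_sub k₁ (c := Y₁) (by rw [← hY₂, ← hM₂, ← e2]; omega)
    rw [← hY₂, ← hM₂, ← e2] at this
    refine this.trans (sub_le_sub_right (Real.log_le_log ?_ ?_) _)
    · exact_mod_cast (by omega : 0 < X - M₂ * Y₁)
    · exact_mod_cast (by omega : X - M₂ * Y₁ ≤ X)
  have r3 : lrad X ≤ C + lrad d := by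
    have s1 := lrad_mul_le (Y₁ * Y₂) T
    have s2 := lrad_pow_le d (2 * (k₁ * k₂))
    have s3 := lrad_le (mul_pos pY₁ pY₂).ne'
    linarith
  have hlX : Real.log X = C + K * Real.log d := by
    rw [hX, Int.cast_mul, Real.log_mul, hT, Int.cast_pow, Real.log_pow, ← hC, hK]
    · push_cast; ring
    · exact_mod_cast (mul_pos pY₁ pY₂).ne'
    · exact_mod_cast (hd.trans_le hdT).ne'
  have r4 := h₁.lrad_le
  have r5 := h₂.lrad_le
  have a1 := abs_le.1 h₁.abs_log
  have a2 := abs_le.1 h₂.abs_log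
  have l2 := Real.log_pos one_lt_two
  rw [← hy₁] at a1
  rw [← hy₂] at a2
  have pl : 0 ≤ Real.log d := log_int_nonneg d
  rw [hlX] at h3 r1 r2
  have f1 : k₂ * Real.log g₂ ≤ B + Real.log g₁ + ε * K * Real.log d := by
    rw [hB]; linarith
  have f2 : k₁ * Real.log g₁ ≤ B + Real.log g₂ + ε * K * Real.log d := by
    rw [hB]; linarith
  have eK : y₁ * y₂ * (ε * K * Real.log d) = Real.log d / 2 := by rw [hε]; field_simp
  have eK' : y₂ * y₁ * (ε * K * Real.log d) = Real.log d / 2 := by rw [mul_comm y₂, eK]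
  have hcase : x₂ + k₂ + 1 ≤ k₂ * (x₁ + k₁) ∨ x₁ + k₁ + 1 ≤ k₁ * (x₂ + k₂) := by
    by_contra hcon
    push Not at hcon
    obtain ⟨i1, i2⟩ := hcon
    have : k₁ = 1 := by nlinarith
    subst this
    have : k₂ = 1 := by nlinarith
    subst this
    omega
  rcases hcase with hc | hc
  · have hc' : y₂ + 1 ≤ k₂ * y₁ := by rw [hy₁, hy₂]; exact_mod_cast hc
    exact (le_of_weighted_bound py₁ py₂ (by linarith) pl f1 eK (by linarith) (by linarith)
      hc').trans (le_max_left _ _)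
  · have hc' : y₁ + 1 ≤ k₁ * y₂ := by rw [hy₁, hy₂]; exact_mod_cast hc
    exact (le_of_weighted_bound py₂ py₁ (by linarith) pl f2 eK' (by linarith) (by linarith)
      hc').trans (le_max_right _ _)

/-- Two representations of `d` with the greatest common divisor of `g₁ ^ x₁` and `g₂ ^ x₂`
split off. -/
structure RedPair (d : ℤ) (g₁ x₁ k₁ : ℕ) (σ₁ : ℤ) (g₂ x₂ k₂ : ℕ) (σ₂ : ℤ)
    (t w₁ w₂ n₁ n₂ m : ℕ) : Prop where
  rep₁ : IsRep d g₁ x₁ k₁ σ₁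
  rep₂ : IsRep d g₂ x₂ k₂ σ₂
  one_le₁ : 1 ≤ n₁
  one_le₂ : 1 ≤ n₂
  coprime_n : Nat.Coprime n₁ n₂
  mul_eq : x₁ * n₁ = x₂ * n₂
  base₁ : g₁ = t ^ n₁ * w₁
  base₂ : g₂ = t ^ n₂ * w₂
  add₁ : (g₁ : ℤ) ^ k₁ + σ₁ = (w₂ : ℤ) ^ x₂ * m
  add₂ : (g₂ : ℤ) ^ k₂ + σ₂ = (w₁ : ℤ) ^ x₁ * m
  cop₁ : Nat.Coprime t w₁
  cop₂ : Nat.Coprime t w₂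
  cop : Nat.Coprime w₁ w₂

lemma IsRep.isCoprime {d : ℤ} {g x k : ℕ} {σ : ℤ} (h : IsRep d g x k σ) :
    IsCoprime ((g : ℤ) ^ k + σ) g := by
  obtain ⟨k, rfl⟩ := Nat.exists_eq_add_of_le' h.one_le_k
  refine ⟨σ, -(g : ℤ) ^ k * σ, ?_⟩
  rcases h.sign with rfl | rfl <;> ring

lemma IsRep.exists_redPair {d : ℤ} {g₁ x₁ k₁ : ℕ} {σ₁ : ℤ} {g₂ x₂ k₂ : ℕ} {σ₂ : ℤ}
    (h₁ : IsRep d g₁ x₁ k₁ σ₁) (h₂ : IsRep d g₂ x₂ k₂ σ₂) :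
    ∃ t w₁ w₂ n₁ n₂ m : ℕ, RedPair d g₁ x₁ k₁ σ₁ g₂ x₂ k₂ σ₂ t w₁ w₂ n₁ n₂ m := by
  obtain ⟨N₁, hN₁⟩ := Int.eq_ofNat_of_zero_le h₁.add_pos.le
  obtain ⟨N₂, hN₂⟩ := Int.eq_ofNat_of_zero_le h₂.add_pos.le
  have c₁ : Nat.Coprime N₁ g₁ := by
    have := h₁.isCoprime; rw [hN₁] at this; exact Nat.isCoprime_iff_coprime.1 this
  have c₂ : Nat.Coprime N₂ g₂ := by
    have := h₂.isCoprime; rw [hN₂] at this; exact Nat.isCoprime_iff_coprime.1 this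
  have heq : g₁ ^ x₁ * N₁ = g₂ ^ x₂ * N₂ := by
    have := h₁.eq.trans h₂.eq.symm
    rw [hN₁, hN₂] at this
    exact_mod_cast this
  have hx₁ := h₁.one_le_x
  have hx₂ := h₂.one_le_x
  have hP : 0 < g₁ ^ x₁ := pow_pos (by have := h₁.two_le; omega) _
  have hU : 0 < Nat.gcd (g₁ ^ x₁) (g₂ ^ x₂) := Nat.gcd_pos_of_pos_left _ hP
  obtain ⟨p, hp⟩ := Nat.gcd_dvd_left (g₁ ^ x₁) (g₂ ^ x₂)
  obtain ⟨q, hq⟩ := Nat.gcd_dvd_right (g₁ ^ x₁) (g₂ ^ x₂)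
  have hpq : Nat.Coprime p q := by
    have := Nat.coprime_div_gcd_div_gcd hU
    rwa [Nat.div_eq_of_eq_mul_right hU hp, Nat.div_eq_of_eq_mul_right hU hq] at this
  set U := Nat.gcd (g₁ ^ x₁) (g₂ ^ x₂) with hUdef
  have heq' : p * N₁ = q * N₂ := by
    rw [hp, hq, mul_assoc, mul_assoc] at heq
    exact Nat.eq_of_mul_eq_mul_left hU heq
  obtain ⟨m, hm⟩ : p ∣ N₂ := hpq.dvd_of_dvd_mul_left ⟨N₁, heq'.symm⟩
  have hp0 : 0 < p := Nat.pos_of_ne_zero (by rintro rfl; rw [mul_zero] at hp; omega)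
  have hm' : N₁ = q * m := by
    rw [hm, mul_left_comm] at heq'
    exact Nat.eq_of_mul_eq_mul_left hp0 heq'
  have hpU : Nat.Coprime U p := by
    have h3 : Nat.Coprime N₂ (g₂ ^ x₂) := c₂.pow_right _
    exact (h3.coprime_dvd_left ⟨m, hm⟩).symm.coprime_dvd_left ⟨q, hq⟩
  have hqU : Nat.Coprime U q := by
    have h3 : Nat.Coprime N₁ (g₁ ^ x₁) := c₁.pow_right _
    exact (h3.coprime_dvd_left ⟨m, hm'⟩).symm.coprime_dvd_left ⟨p, hp⟩
  have root : ∀ {a b c n : ℕ}, Nat.Coprime a b → a * b = c ^ n → ∃ e, a = e ^ n :=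
    fun hab h => exists_eq_pow_of_mul_eq_pow (Nat.isUnit_iff.2 hab) h
  obtain ⟨u₁, hu₁⟩ := root hpU hp.symm
  obtain ⟨w₁, hw₁⟩ := root hpU.symm (by rw [mul_comm, ← hp])
  obtain ⟨u₂, hu₂⟩ := root hqU hq.symm
  obtain ⟨w₂, hw₂⟩ := root hqU.symm (by rw [mul_comm, ← hq])
  obtain ⟨t, ht₁, ht₂⟩ := Nat.exists_eq_pow_of_pow_eq_pow (Or.inl (by omega))
    (hu₁.symm.trans hu₂)
  have he : 0 < Nat.gcd x₁ x₂ := Nat.gcd_pos_of_pos_left _ hx₁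
  have hn₁ : 1 ≤ x₂ / Nat.gcd x₁ x₂ :=
    (Nat.one_le_div_iff he).2 (Nat.le_of_dvd hx₂ (Nat.gcd_dvd_right _ _))
  have hn₂ : 1 ≤ x₁ / Nat.gcd x₁ x₂ :=
    (Nat.one_le_div_iff he).2 (Nat.le_of_dvd hx₁ (Nat.gcd_dvd_left _ _))
  refine ⟨t, w₁, w₂, x₂ / Nat.gcd x₁ x₂, x₁ / Nat.gcd x₁ x₂, m, h₁, h₂, hn₁, hn₂,
    (Nat.coprime_div_gcd_div_gcd he).symm, ?_, ?_, ?_, ?_, ?_, ?_, ?_, ?_⟩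
  · rw [← Nat.mul_div_assoc _ (Nat.gcd_dvd_right _ _), ← Nat.mul_div_assoc _ (Nat.gcd_dvd_left _ _),
      mul_comm]
  · refine Nat.pow_left_injective (by omega : x₁ ≠ 0) ?_
    simp only
    rw [← ht₁, mul_pow, ← hu₁, ← hw₁, hp]
  · refine Nat.pow_left_injective (by omega : x₂ ≠ 0) ?_
    simp only
    rw [← ht₂, mul_pow, ← hu₂, ← hw₂, hq]
  · rw [hN₁, hm', hw₂]; push_cast; rfl
  · rw [hN₂, hm, hw₁]; push_cast; rfl
  · rw [hu₁, hw₁, ht₁, ← pow_mul] at hpU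
    exact (Nat.coprime_pow_left_iff (by positivity) _ _).1
      ((Nat.coprime_pow_right_iff hx₁ _ _).1 hpU)
  · rw [hu₂, hw₂, ht₂, ← pow_mul] at hqU
    exact (Nat.coprime_pow_left_iff (by positivity) _ _).1
      ((Nat.coprime_pow_right_iff hx₂ _ _).1 hqU)
  · rw [hw₁, hw₂] at hpq
    exact (Nat.coprime_pow_left_iff hx₁ _ _).1 ((Nat.coprime_pow_right_iff hx₂ _ _).1 hpq)

namespace RedPair

variable {d : ℤ} {g₁ x₁ k₁ : ℕ} {σ₁ : ℤ} {g₂ x₂ k₂ : ℕ} {σ₂ : ℤ} {t w₁ w₂ n₁ n₂ m : ℕ}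

lemma swap (h : RedPair d g₁ x₁ k₁ σ₁ g₂ x₂ k₂ σ₂ t w₁ w₂ n₁ n₂ m) :
    RedPair d g₂ x₂ k₂ σ₂ g₁ x₁ k₁ σ₁ t w₂ w₁ n₂ n₁ m :=
  ⟨h.rep₂, h.rep₁, h.one_le₂, h.one_le₁, h.coprime_n.symm, h.mul_eq.symm, h.base₂, h.base₁,
    h.add₂, h.add₁, h.cop₂, h.cop₁, h.cop.symm⟩

lemma w_pos (h : RedPair d g₁ x₁ k₁ σ₁ g₂ x₂ k₂ σ₂ t w₁ w₂ n₁ n₂ m) : 0 < w₁ := by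
  have h1 := h.rep₁.two_le
  have h2 := h.base₁
  refine Nat.pos_of_ne_zero ?_
  rintro rfl
  omega

lemma t_pos (h : RedPair d g₁ x₁ k₁ σ₁ g₂ x₂ k₂ σ₂ t w₁ w₂ n₁ n₂ m) : 0 < t := by
  have h1 := h.rep₁.two_le
  have h2 := h.base₁
  refine Nat.pos_of_ne_zero ?_
  rintro rfl
  rw [zero_pow (by have := h.one_le₁; omega)] at h2
  omega

lemma m_pos (h : RedPair d g₁ x₁ k₁ σ₁ g₂ x₂ k₂ σ₂ t w₁ w₂ n₁ n₂ m) : 0 < m := by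
  have h1 := h.rep₁.add_pos
  rw [h.add₁] at h1
  refine Nat.pos_of_ne_zero ?_
  rintro rfl
  simp at h1

lemma log_base (h : RedPair d g₁ x₁ k₁ σ₁ g₂ x₂ k₂ σ₂ t w₁ w₂ n₁ n₂ m) :
    Real.log g₁ = n₁ * Real.log t + Real.log w₁ := by
  have h1 : (t : ℝ) ^ n₁ ≠ 0 := by exact_mod_cast (pow_pos h.t_pos _).ne'
  have h2 : (w₁ : ℝ) ≠ 0 := by exact_mod_cast h.w_pos.ne'
  rw [h.base₁, Nat.cast_mul, Nat.cast_pow, Real.log_mul h1 h2, Real.log_pow]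

lemma log_add (h : RedPair d g₁ x₁ k₁ σ₁ g₂ x₂ k₂ σ₂ t w₁ w₂ n₁ n₂ m) :
    Real.log (((g₁ : ℤ) ^ k₁ + σ₁ : ℤ) : ℝ) = x₂ * Real.log w₂ + Real.log m := by
  have h1 : (w₂ : ℝ) ^ x₂ ≠ 0 := by exact_mod_cast (pow_pos h.swap.w_pos _).ne'
  have h2 : (m : ℝ) ≠ 0 := by exact_mod_cast h.m_pos.ne'
  rw [h.add₁, Int.cast_mul, Int.cast_pow, Int.cast_natCast, Int.cast_natCast,
    Real.log_mul h1 h2, Real.log_pow]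

lemma abs_log (h : RedPair d g₁ x₁ k₁ σ₁ g₂ x₂ k₂ σ₂ t w₁ w₂ n₁ n₂ m) :
    |x₂ * Real.log w₂ + Real.log m - k₁ * Real.log g₁| ≤ Real.log 2 := by
  rw [← h.log_add]
  exact h.rep₁.abs_log_add

lemma lrad_base_le (h : RedPair d g₁ x₁ k₁ σ₁ g₂ x₂ k₂ σ₂ t w₁ w₂ n₁ n₂ m) (N : ℕ) :
    lrad ((g₁ : ℤ) ^ N) ≤ Real.log t + Real.log w₁ := by
  refine (lrad_pow_le _ _).trans ?_
  rw [h.base₁, Nat.cast_mul, Nat.cast_pow]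
  refine (lrad_mul_le _ _).trans (add_le_add ((lrad_pow_le _ _).trans ?_) ?_)
  · simpa using lrad_le (n := (t : ℤ)) (by have := h.t_pos; omega)
  · simpa using lrad_le (n := (w₁ : ℤ)) (by have := h.w_pos; omega)

/-- The difference of the two cross terms. -/
lemma cross_eq (h : RedPair d g₁ x₁ k₁ σ₁ g₂ x₂ k₂ σ₂ t w₁ w₂ n₁ n₂ m) :
    (w₁ : ℤ) ^ x₁ * (g₁ : ℤ) ^ k₁ + -((w₂ : ℤ) ^ x₂ * (g₂ : ℤ) ^ k₂) =
      σ₂ * (w₂ : ℤ) ^ x₂ - σ₁ * (w₁ : ℤ) ^ x₁ := by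
  linear_combination (w₁ : ℤ) ^ x₁ * h.add₁ - (w₂ : ℤ) ^ x₂ * h.add₂

lemma mul_eq_mul_of_exponents_eq (h : RedPair d g₁ x₁ k₁ σ₁ g₂ x₂ k₂ σ₂ t w₁ w₂ n₁ n₂ m)
    (he : n₁ * k₁ = n₂ * k₂) : x₁ * k₂ = x₂ * k₁ := by
  have h1 := h.mul_eq
  have : n₁ * n₂ ≠ 0 := by have := h.one_le₁; have := h.one_le₂; positivity
  refine Nat.eq_of_mul_eq_mul_left (Nat.pos_of_ne_zero this) ?_
  calc n₁ * n₂ * (x₁ * k₂) = (x₁ * n₁) * (n₂ * k₂) := by ring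
    _ = (x₂ * n₂) * (n₁ * k₁) := by rw [h1, he]
    _ = _ := by ring

lemma cross_ne_zero (h : RedPair d g₁ x₁ k₁ σ₁ g₂ x₂ k₂ σ₂ t w₁ w₂ n₁ n₂ m)
    (hne : x₁ * k₂ ≠ x₂ * k₁) : σ₂ * (w₂ : ℤ) ^ x₂ - σ₁ * (w₁ : ℤ) ^ x₁ ≠ 0 := by
  intro h0
  have p1 : 0 < (w₁ : ℤ) ^ x₁ := pow_pos (by exact_mod_cast h.w_pos) _
  have p2 : 0 < (w₂ : ℤ) ^ x₂ := pow_pos (by exact_mod_cast h.swap.w_pos) _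
  have hσ : σ₁ = σ₂ ∧ (w₁ : ℤ) ^ x₁ = (w₂ : ℤ) ^ x₂ := by
    rcases h.rep₁.sign with h1 | h1 <;> rcases h.rep₂.sign with h2 | h2 <;> subst h1 <;>
      subst h2 <;> constructor <;> omega
  have hw : w₁ ^ x₁ = w₂ ^ x₂ := by exact_mod_cast hσ.2
  have hc : Nat.Coprime (w₁ ^ x₁) (w₂ ^ x₂) := (h.cop.pow_left _).pow_right _
  rw [hw, Nat.coprime_self] at hc
  have hw2 : w₂ = 1 := (Nat.pow_eq_one.1 hc).resolve_right (by have := h.rep₂.one_le_x; omega)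
  have hw1 : w₁ = 1 :=
    (Nat.pow_eq_one.1 (hw.trans hc)).resolve_right (by have := h.rep₁.one_le_x; omega)
  have e1 := h.add₁
  have e2 := h.add₂
  have b1 := h.base₁
  have b2 := h.base₂
  subst hw1 hw2
  rw [mul_one] at b1 b2
  subst b1 b2
  have ht : 2 ≤ t := by
    have := h.rep₁.two_le
    by_contra hlt
    have := h.t_pos
    have : t = 1 := by omega
    subst this
    simp at *
  have : t ^ (n₁ * k₁) = t ^ (n₂ * k₂) := by
    have : ((t ^ n₁ : ℕ) : ℤ) ^ k₁ = ((t ^ n₂ : ℕ) : ℤ) ^ k₂ := by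
      have := hσ.1
      simp only [Nat.cast_one, one_pow, one_mul] at e1 e2
      omega
    rw [pow_mul, pow_mul]
    exact_mod_cast this
  exact hne (h.mul_eq_mul_of_exponents_eq (Nat.pow_right_injective ht this))

end RedPair

lemma ABCConjecture.log_le_mul (habc : ABCConjecture) {ε : ℝ} (hε : 0 < ε) :
    ∃ κ : ℝ, 0 ≤ κ ∧ ∀ A B C : ℤ, A ≠ 0 → B ≠ 0 → C ≠ 0 → A + B = C →
      Real.log A ≤ κ + (1 + ε) * (lrad (A * B) + Real.log C) := by
  obtain ⟨κ, hκ, h⟩ := habc.log_le hε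
  refine ⟨κ, hκ, fun A B C hA hB hC hABC => ?_⟩
  obtain ⟨G, A', B', C', hG, rfl, rfl, rfl, h1, h2⟩ := exists_coprime_triple hA hABC
  have hA' := right_ne_zero_of_mul hA
  have hB' := right_ne_zero_of_mul hB
  have hC' := right_ne_zero_of_mul hC
  have h3 := h A' B' C' hA' hB' hC' h1 h2
  have h4 := lrad_mul_le (A' * B') C'
  have h5 : lrad (A' * B') ≤ lrad (G * A' * (G * B')) :=
    lrad_le_of_dvd (mul_ne_zero hA hB) ⟨G * G, by ring⟩
  have h7 := lrad_le hC'
  have h8 : 0 ≤ Real.log (G : ℝ) := Real.log_natCast_nonneg _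
  rw [Int.cast_mul, Int.cast_mul, Int.cast_natCast,
    Real.log_mul (by exact_mod_cast hG) (by exact_mod_cast hA'),
    Real.log_mul (by exact_mod_cast hG) (by exact_mod_cast hC')]
  have h9 : (1 + ε) * lrad (A' * B' * C') ≤
      (1 + ε) * (lrad (G * A' * (G * B')) + Real.log C') :=
    mul_le_mul_of_nonneg_left (by linarith) (by linarith)
  have : 0 ≤ ε * Real.log (G : ℝ) := by positivity
  linarith

lemma lrad_sign {σ : ℤ} (h : σ = 1 ∨ σ = -1) : lrad σ = 0 := by
  rcases h with rfl | rfl <;> simp [lrad, rad]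

lemma lrad_pow_natCast_le {n : ℕ} (hn : 0 < n) (k : ℕ) : lrad ((n : ℤ) ^ k) ≤ Real.log n := by
  refine (lrad_pow_le _ _).trans ?_
  simpa using lrad_le (n := (n : ℤ)) (by omega)

lemma Real.log_two_le_one : Real.log 2 ≤ 1 := by linarith [Real.log_two_lt_d9]

namespace RedPair

variable {d : ℤ} {g₁ x₁ k₁ : ℕ} {σ₁ : ℤ} {g₂ x₂ k₂ : ℕ} {σ₂ : ℤ} {t w₁ w₂ n₁ n₂ m : ℕ}

lemma log_cross_le (h : RedPair d g₁ x₁ k₁ σ₁ g₂ x₂ k₂ σ₂ t w₁ w₂ n₁ n₂ m)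
    (hne : x₁ * k₂ ≠ x₂ * k₁) :
    Real.log ((σ₂ * (w₂ : ℤ) ^ x₂ - σ₁ * (w₁ : ℤ) ^ x₁ : ℤ) : ℝ) ≤
      1 + max (x₁ * Real.log w₁) (x₂ * Real.log w₂) := by
  have hC := h.cross_ne_zero hne
  have p1 : 0 < (w₁ : ℝ) ^ x₁ := pow_pos (by exact_mod_cast h.w_pos) _
  have p2 : 0 < (w₂ : ℝ) ^ x₂ := pow_pos (by exact_mod_cast h.swap.w_pos) _
  have hle : |((σ₂ * (w₂ : ℤ) ^ x₂ - σ₁ * (w₁ : ℤ) ^ x₁ : ℤ) : ℝ)| ≤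
      2 * max ((w₁ : ℝ) ^ x₁) ((w₂ : ℝ) ^ x₂) := by
    have m1 := le_max_left ((w₁ : ℝ) ^ x₁) ((w₂ : ℝ) ^ x₂)
    have m2 := le_max_right ((w₁ : ℝ) ^ x₁) ((w₂ : ℝ) ^ x₂)
    rw [abs_le]
    rcases h.rep₁.sign with h1 | h1 <;> rcases h.rep₂.sign with h2 | h2 <;> subst h1 <;>
      subst h2 <;> push_cast <;> constructor <;> linarith
  rw [← Real.log_abs]
  refine (Real.log_le_log (abs_pos.2 (by exact_mod_cast hC)) hle).trans ?_
  rw [Real.log_mul two_ne_zero (by positivity)]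
  refine add_le_add Real.log_two_le_one ?_
  rw [← Real.log_pow, ← Real.log_pow]
  rcases max_cases ((w₁ : ℝ) ^ x₁) ((w₂ : ℝ) ^ x₂) with h1 | h1 <;> rw [h1.1]
  · exact le_max_left _ _
  · exact le_max_right _ _

end RedPair

/-- The two consequences of ABC for a pair of representations. -/
theorem ABCConjecture.redPair_bounds (habc : ABCConjecture) {ε : ℝ} (hε : 0 < ε) :
    ∃ κ : ℝ, 0 ≤ κ ∧ ∀ (d : ℤ) (g₁ x₁ k₁ : ℕ) (σ₁ : ℤ) (g₂ x₂ k₂ : ℕ) (σ₂ : ℤ)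
      (t w₁ w₂ n₁ n₂ m : ℕ), RedPair d g₁ x₁ k₁ σ₁ g₂ x₂ k₂ σ₂ t w₁ w₂ n₁ n₂ m →
      x₁ * k₂ ≠ x₂ * k₁ → ∀ R S : ℝ,
      R = x₁ * Real.log w₁ + x₂ * Real.log w₂ + Real.log m →
      S = Real.log t + Real.log w₁ + Real.log w₂ →
      x₁ * Real.log w₁ ≤ κ + S + ε * R ∧
      x₂ * Real.log w₂ ≤ κ + S + ε * R ∧
      R ≤ κ + S + max (x₁ * Real.log w₁) (x₂ * Real.log w₂) + ε * R := by
  have hε3 : 0 < ε / 3 := by positivity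
  obtain ⟨κ₁, hκ₁, H₁⟩ := habc.log_le hε3
  obtain ⟨κ₂, hκ₂, H₂⟩ := habc.log_le_mul hε3
  have key : ∀ (d : ℤ) (g₁ x₁ k₁ : ℕ) (σ₁ : ℤ) (g₂ x₂ k₂ : ℕ) (σ₂ : ℤ)
      (t w₁ w₂ n₁ n₂ m : ℕ), RedPair d g₁ x₁ k₁ σ₁ g₂ x₂ k₂ σ₂ t w₁ w₂ n₁ n₂ m →
      x₂ * Real.log w₂ + Real.log m ≤
        κ₁ + (1 + ε / 3) * (Real.log t + Real.log w₁ + Real.log w₂ + Real.log m) := by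
    intro d g₁ x₁ k₁ σ₁ g₂ x₂ k₂ σ₂ t w₁ w₂ n₁ n₂ m h
    have hA : (w₂ : ℤ) ^ x₂ * m ≠ 0 := by rw [← h.add₁]; exact h.rep₁.add_pos.ne'
    have hσ : -σ₁ = 1 ∨ -σ₁ = -1 := by rcases h.rep₁.sign with h | h <;> omega
    have hC : (g₁ : ℤ) ^ k₁ ≠ 0 := by have := h.rep₁.two_le_pow h.rep₁.one_le_k; omega
    have h1 := H₁ _ (-σ₁) _ hA (by omega) hC (by rw [← h.add₁]; ring)
      (Int.isCoprime_iff_gcd_eq_one.1 (by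
        rcases hσ with h | h <;> rw [h]
        exacts [isCoprime_one_right, isCoprime_one_right.neg_right]))
    rw [← h.add₁, h.log_add, h.add₁] at h1
    refine h1.trans (add_le_add le_rfl (mul_le_mul_of_nonneg_left ?_ (by linarith)))
    have h2 := lrad_mul_three_le ((w₂ : ℤ) ^ x₂ * m) (-σ₁) ((g₁ : ℤ) ^ k₁)
    have h3 := lrad_mul_le ((w₂ : ℤ) ^ x₂) m
    have h4 := lrad_pow_natCast_le h.swap.w_pos x₂
    have h5 := lrad_le (n := (m : ℤ)) (by have := h.m_pos; omega)
    have h6 := h.lrad_base_le k₁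
    have h7 := lrad_sign hσ
    rw [Int.cast_natCast] at h5
    linarith
  refine ⟨κ₁ + κ₂ + 3 + 3 * ε, by positivity, ?_⟩
  intro d g₁ x₁ k₁ σ₁ g₂ x₂ k₂ σ₂ t w₁ w₂ n₁ n₂ m h hne R S hR hS
  have l2 := Real.log_two_le_one
  have i1 := key _ _ _ _ _ _ _ _ _ _ _ _ _ _ _ h
  have i2 := key _ _ _ _ _ _ _ _ _ _ _ _ _ _ _ h.swap
  rw [← hS] at i1
  rw [add_right_comm (Real.log t), ← hS] at i2
  have a1 := abs_le.1 h.abs_log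
  have b1 := h.log_base
  have pL : 0 ≤ Real.log (t : ℝ) := Real.log_natCast_nonneg _
  have pa1 : 0 ≤ Real.log (w₁ : ℝ) := Real.log_natCast_nonneg _
  have pa2 : 0 ≤ Real.log (w₂ : ℝ) := Real.log_natCast_nonneg _
  have pm : 0 ≤ Real.log (m : ℝ) := Real.log_natCast_nonneg _
  have c1 : (1 : ℝ) ≤ x₁ := by exact_mod_cast h.rep₁.one_le_x
  have c2 : (1 : ℝ) ≤ x₂ := by exact_mod_cast h.rep₂.one_le_x
  have c3 : (1 : ℝ) ≤ k₁ := by exact_mod_cast h.rep₁.one_le_k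
  have c4 : (1 : ℝ) ≤ n₁ := by exact_mod_cast h.one_le₁
  have q1 := mul_le_mul_of_nonneg_right c1 pa1
  have q2 := mul_le_mul_of_nonneg_right c2 pa2
  have q3 := mul_le_mul_of_nonneg_right c4 pL
  have q4 : 1 * Real.log g₁ ≤ k₁ * Real.log g₁ :=
    mul_le_mul_of_nonneg_right c3 (Real.log_natCast_nonneg _)
  have hSm : S + Real.log m ≤ 2 * R + 1 := by linarith
  have hSm' := mul_le_mul_of_nonneg_left hSm hε3.le
  have pR : 0 ≤ R := by rw [hR]; positivity
  have peR : 0 ≤ ε * R := by positivity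
  refine ⟨by linarith, by linarith, ?_⟩
  have p1 : 0 < (w₁ : ℤ) ^ x₁ := pow_pos (by exact_mod_cast h.w_pos) _
  have p2 : 0 < (w₂ : ℤ) ^ x₂ := pow_pos (by exact_mod_cast h.swap.w_pos) _
  have p3 : (0 : ℤ) < (g₁ : ℤ) ^ k₁ := by have := h.rep₁.two_le_pow h.rep₁.one_le_k; omega
  have p4 : (0 : ℤ) < (g₂ : ℤ) ^ k₂ := by have := h.rep₂.two_le_pow h.rep₂.one_le_k; omega
  have h2 := H₂ _ _ _ (mul_pos p1 p3).ne' (neg_ne_zero.2 (mul_pos p2 p4).ne')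
    (h.cross_ne_zero hne) h.cross_eq
  have h3 := h.log_cross_le hne
  have h4 : lrad ((w₁ : ℤ) ^ x₁ * (g₁ : ℤ) ^ k₁ * -((w₂ : ℤ) ^ x₂ * (g₂ : ℤ) ^ k₂)) ≤ S := by
    have e : (w₁ : ℤ) ^ x₁ * (g₁ : ℤ) ^ k₁ * -((w₂ : ℤ) ^ x₂ * (g₂ : ℤ) ^ k₂) =
        -((t : ℤ) ^ (n₁ * k₁ + n₂ * k₂) * (w₁ : ℤ) ^ (x₁ + k₁) * (w₂ : ℤ) ^ (x₂ + k₂)) := by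
      rw [h.base₁, h.base₂]
      push_cast
      ring
    rw [e, lrad_neg]
    have := lrad_mul_three_le ((t : ℤ) ^ (n₁ * k₁ + n₂ * k₂)) ((w₁ : ℤ) ^ (x₁ + k₁))
      ((w₂ : ℤ) ^ (x₂ + k₂))
    have := lrad_pow_natCast_le h.t_pos (n₁ * k₁ + n₂ * k₂)
    have := lrad_pow_natCast_le h.w_pos (x₁ + k₁)
    have := lrad_pow_natCast_le h.swap.w_pos (x₂ + k₂)
    linarith
  have h5 : Real.log (((w₁ : ℤ) ^ x₁ * (g₁ : ℤ) ^ k₁ : ℤ) : ℝ) =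
      x₁ * Real.log w₁ + k₁ * Real.log g₁ := by
    rw [Int.cast_mul, Int.cast_pow, Int.cast_pow, Int.cast_natCast, Int.cast_natCast,
      Real.log_mul, Real.log_pow, Real.log_pow]
    · exact_mod_cast p1.ne'
    · exact_mod_cast p3.ne'
  have h6 : max (x₁ * Real.log w₁) (x₂ * Real.log w₂) ≤ R := by
    refine max_le ?_ ?_ <;> rw [hR]
    · have : 0 ≤ x₂ * Real.log w₂ := by positivity
      linarith
    · have : 0 ≤ x₁ * Real.log w₁ := by positivity
      linarith
  have h7 : ε / 3 * (S + (1 + max (x₁ * Real.log w₁) (x₂ * Real.log w₂))) ≤ ε / 3 * (3 * R + 2) :=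
    mul_le_mul_of_nonneg_left (by linarith) hε3.le
  have h8 := mul_le_mul_of_nonneg_left (add_le_add h4 h3) (by linarith : 0 ≤ 1 + ε / 3)
  rw [h5] at h2
  linarith

namespace RedPair

variable {d : ℤ} {g₁ x₁ k₁ : ℕ} {σ₁ : ℤ} {g₂ x₂ k₂ : ℕ} {σ₂ : ℤ} {t w₁ w₂ n₁ n₂ m : ℕ}

lemma log_bounds (h : RedPair d g₁ x₁ k₁ σ₁ g₂ x₂ k₂ σ₂ t w₁ w₂ n₁ n₂ m) :
    (1 / 2 : ℝ) ≤ Real.log g₁ ∧ Real.log t + Real.log w₁ ≤ Real.log g₁ ∧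
      k₁ * Real.log g₁ ≤ x₂ * Real.log w₂ + Real.log m + 1 ∧
      x₂ * Real.log w₂ + Real.log m ≤ k₁ * Real.log g₁ + 1 ∧
      (n₁ * k₁ : ℕ) * Real.log t ≤ k₁ * Real.log g₁ := by
  have a1 := abs_le.1 h.abs_log
  have l2 := Real.log_two_le_one
  have l2' := Real.log_two_gt_d9
  have b1 := h.log_base
  have c4 : (1 : ℝ) ≤ n₁ := by exact_mod_cast h.one_le₁
  have pL : 0 ≤ Real.log (t : ℝ) := Real.log_natCast_nonneg _
  have q3 := mul_le_mul_of_nonneg_right c4 pL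
  have pa : 0 ≤ k₁ * Real.log (w₁ : ℝ) := by
    have := Real.log_natCast_nonneg w₁
    positivity
  refine ⟨by linarith [h.rep₁.log_pos], by linarith, by linarith, by linarith, ?_⟩
  rw [b1]
  push_cast
  linarith

lemma mul_log_le (h : RedPair d g₁ x₁ k₁ σ₁ g₂ x₂ k₂ σ₂ t w₁ w₂ n₁ n₂ m) :
    (x₂ + k₂) * Real.log g₂ ≤ (x₁ + k₁) * Real.log g₁ + 2 := by
  have a1 := abs_le.1 h.rep₁.abs_log
  have a2 := abs_le.1 h.rep₂.abs_log
  have l2 := Real.log_two_le_one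
  linarith

lemma one_lt_t (h : RedPair d g₁ x₁ k₁ σ₁ g₂ x₂ k₂ σ₂ t w₁ w₂ n₁ n₂ m) (hw : w₁ = 1) : 1 < t := by
  have h1 := h.rep₁.two_le
  rw [h.base₁, hw, mul_one] at h1
  by_contra hlt
  have : t = 1 := by have := h.t_pos; omega
  rw [this, one_pow] at h1
  omega

/-- If `w₁ ^ x₁ * w₂ ^ x₂ * m` is bounded and an exponent is large, then both bases equal `2`. -/
lemma eq_two_of_le (h : RedPair d g₁ x₁ k₁ σ₁ g₂ x₂ k₂ σ₂ t w₁ w₂ n₁ n₂ m)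
    (hne : x₁ * k₂ ≠ x₂ * k₁) (hp₁ : ¬ IsPerfectPow g₁) (hp₂ : ¬ IsPerfectPow g₂) {R₀ : ℝ}
    (hR : x₁ * Real.log w₁ + x₂ * Real.log w₂ + Real.log m ≤ R₀)
    (hy : 4 * (R₀ + 1) ^ 2 + 4 * (R₀ + 3) ≤ x₂ + k₂) : g₁ = 2 ∧ g₂ = 2 := by
  obtain ⟨u1, -, u2, -, -⟩ := h.log_bounds
  obtain ⟨v1, -, v2, -, -⟩ := h.swap.log_bounds
  have hml := h.mul_log_le
  have pa1 : 0 ≤ Real.log (w₁ : ℝ) := Real.log_natCast_nonneg _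
  have pa2 : 0 ≤ Real.log (w₂ : ℝ) := Real.log_natCast_nonneg _
  have pm : 0 ≤ Real.log (m : ℝ) := Real.log_natCast_nonneg _
  have px1 : 0 ≤ x₁ * Real.log (w₁ : ℝ) := by positivity
  have px2 : 0 ≤ x₂ * Real.log (w₂ : ℝ) := by positivity
  have pR : 0 ≤ R₀ := by linarith
  have c3 : (1 : ℝ) ≤ k₁ := by exact_mod_cast h.rep₁.one_le_k
  have c4 : (1 : ℝ) ≤ k₂ := by exact_mod_cast h.rep₂.one_le_k
  have q3 := mul_le_mul_of_nonneg_right c3 (by linarith : 0 ≤ Real.log (g₁ : ℝ))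
  have q4 := mul_le_mul_of_nonneg_right c4 (by linarith : 0 ≤ Real.log (g₂ : ℝ))
  have hy2 : 2 * (R₀ + 1) ^ 2 + 2 * (R₀ + 3) ≤ (x₂ + k₂) * Real.log g₂ := by
    have := mul_le_mul_of_nonneg_left v1 (by positivity : (0 : ℝ) ≤ x₂ + k₂)
    linarith
  have key : ∀ {x w : ℕ} {G : ℝ}, 0 < w → 0 ≤ G → G ≤ R₀ + 1 → x * Real.log w ≤ R₀ →
      2 * (R₀ + 1) ^ 2 < x * G → w = 1 := by
    intro x w G hw hG0 hG hxa hx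
    by_contra hw1
    have hw2 : (2 : ℝ) ≤ w := by exact_mod_cast (by omega : 2 ≤ w)
    have l1 : 1 / 2 ≤ Real.log w := by
      have := Real.log_le_log two_pos hw2
      have := Real.log_two_gt_d9
      linarith
    have l2 := mul_le_mul_of_nonneg_left l1 (Nat.cast_nonneg (α := ℝ) x)
    have l3 := mul_le_mul_of_nonneg_left hG (Nat.cast_nonneg (α := ℝ) x)
    have l4 : (x : ℝ) * (R₀ + 1) ≤ (2 * R₀) * (R₀ + 1) :=
      mul_le_mul_of_nonneg_right (by linarith) (by linarith)
    nlinarith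
  have hw₁ : w₁ = 1 := key h.w_pos (by linarith) (by linarith) (by linarith)
    (show 2 * (R₀ + 1) ^ 2 < x₁ * Real.log g₁ by linarith)
  have hw₂ : w₂ = 1 := key h.swap.w_pos (by linarith) (by linarith) (by linarith)
    (show 2 * (R₀ + 1) ^ 2 < x₂ * Real.log g₂ by linarith)
  have ht := h.one_lt_t hw₁
  have hn : ∀ {g n w : ℕ}, ¬ IsPerfectPow g → 1 ≤ n → w = 1 → g = t ^ n * w → n = 1 := by
    intro g n w hg hn hw hgt
    by_contra hn1
    exact hg ⟨t, n, ht, by omega, by rw [hgt, hw, mul_one]⟩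
  have hn₁ := hn hp₁ h.one_le₁ hw₁ h.base₁
  have hn₂ := hn hp₂ h.one_le₂ hw₂ h.base₂
  have e1 := h.add₁
  have e2 := h.add₂
  have b1 := h.base₁
  have b2 := h.base₂
  have e3 := h.mul_eq
  rw [hn₁, hw₁, pow_one, mul_one] at b1
  rw [hn₂, hw₂, pow_one, mul_one] at b2
  rw [hn₁, hn₂, mul_one, mul_one] at e3
  rw [b1, hw₂, Nat.cast_one, one_pow, one_mul] at e1
  rw [b2, hw₁, Nat.cast_one, one_pow, one_mul] at e2
  have hk : k₁ ≠ k₂ := fun hk => hne (by rw [e3, hk])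
  have hpk : (t : ℤ) ^ k₁ ≠ (t : ℤ) ^ k₂ := by
    intro hpk
    exact hk (Nat.pow_right_injective ht (by exact_mod_cast hpk))
  have d1 : (t : ℤ) ∣ (t : ℤ) ^ k₁ - (t : ℤ) ^ k₂ :=
    dvd_sub (dvd_pow_self _ (by have := h.rep₁.one_le_k; omega))
      (dvd_pow_self _ (by have := h.rep₂.one_le_k; omega))
  have d2 : (t : ℤ) ∣ 2 := by
    rcases h.rep₁.sign with h1 | h1 <;> rcases h.rep₂.sign with h2 | h2 <;> subst h1 <;>
      subst h2
    · omega
    · rw [show (t : ℤ) ^ k₁ - (t : ℤ) ^ k₂ = -2 by omega] at d1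
      exact (dvd_neg.1 d1)
    · rwa [show (t : ℤ) ^ k₁ - (t : ℤ) ^ k₂ = 2 by omega] at d1
    · omega
  have d3 := Int.le_of_dvd two_pos d2
  omega

/-- The case in which the first exponent is `1` and the second exponent is at least `2`. -/
lemma false_of_x_eq_one (h : RedPair d g₁ x₁ k₁ σ₁ g₂ x₂ k₂ σ₂ t w₁ w₂ n₁ n₂ m)
    (hx : x₁ = 1) (hk : 2 ≤ k₁) {R S : ℝ}
    (hR : R = x₁ * Real.log w₁ + x₂ * Real.log w₂ + Real.log m)
    (hS : S = Real.log t + Real.log w₁ + Real.log w₂)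
    (h1 : x₁ * Real.log w₁ ≤ S + R / 500) (h2 : x₂ * Real.log w₂ ≤ S + R / 500)
    (h3 : R ≤ S + max (x₁ * Real.log w₁) (x₂ * Real.log w₂) + R / 500) (hR0 : 1000 ≤ R)
    (hy : 100000 ≤ (x₂ : ℝ) + k₂) : False := by
  obtain ⟨u1, u3, u2, -, -⟩ := h.log_bounds
  obtain ⟨v1, v3, v2, -, -⟩ := h.swap.log_bounds
  have hml := h.mul_log_le
  have hmax := max_le h1 h2
  have pL : 0 ≤ Real.log (t : ℝ) := Real.log_natCast_nonneg _
  have pa1 : 0 ≤ Real.log (w₁ : ℝ) := Real.log_natCast_nonneg _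
  subst hx
  rw [Nat.cast_one, one_mul] at hR
  have hk' : (2 : ℝ) ≤ k₁ := by exact_mod_cast hk
  have i1 : R ≤ 2.01 * S := by linarith
  have i2 : k₁ * Real.log g₁ ≤ 2.013 * Real.log g₂ + 1.013 * Real.log g₁ := by linarith
  have i3 : 0.3 * (1 + k₁) * Real.log g₁ ≤ (k₁ - 1.013) * Real.log g₁ :=
    mul_le_mul_of_nonneg_right (by linarith) (by linarith)
  have i4 := mul_le_mul_of_nonneg_right hy (by linarith : 0 ≤ Real.log (g₂ : ℝ))
  push_cast at hml
  linarith

lemma false_of_one_two (h : RedPair d g₁ x₁ k₁ σ₁ g₂ x₂ k₂ σ₂ t w₁ w₂ n₁ n₂ m)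
    (h₁ : n₁ * k₁ = 1) (h₂ : n₂ * k₂ = 2) (hL : 400 ≤ Real.log t)
    (ha₁ : Real.log w₁ ≤ 0.001 * Real.log t) (ha₂ : Real.log w₂ ≤ 0.001 * Real.log t)
    (hx₁ : x₁ * Real.log w₁ ≤ 1.01 * Real.log t) : False := by
  have a1 := abs_le.1 h.abs_log
  have a2 := abs_le.1 h.swap.abs_log
  rw [h.log_base] at a1
  rw [h.swap.log_base] at a2
  have l2 := Real.log_two_le_one
  set L := Real.log (t : ℝ) with hLdef
  have pa1 : 0 ≤ Real.log (w₁ : ℝ) := Real.log_natCast_nonneg _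
  have pa2 : 0 ≤ Real.log (w₂ : ℝ) := Real.log_natCast_nonneg _
  have hk₁ : k₁ = 1 := Nat.eq_one_of_mul_eq_one_left h₁
  have hn₁ : n₁ = 1 := Nat.eq_one_of_mul_eq_one_right h₁
  have hk₂ : k₂ ≤ 2 := Nat.le_of_dvd two_pos ⟨n₂, by rw [mul_comm, h₂]⟩
  have hk₂' : (k₂ : ℝ) ≤ 2 := by exact_mod_cast hk₂
  have h₂' : (k₂ : ℝ) * (n₂ * L) = 2 * L := by
    rw [← mul_assoc, mul_comm (k₂ : ℝ)]
    have : (n₂ : ℝ) * k₂ = 2 := by exact_mod_cast h₂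
    rw [this]
  have hka : k₂ * Real.log w₂ ≤ 2 * Real.log w₂ := mul_le_mul_of_nonneg_right hk₂' pa2
  have hka0 : 0 ≤ k₂ * Real.log (w₂ : ℝ) := by positivity
  rw [hk₁, hn₁, Nat.cast_one, one_mul, one_mul] at a1
  rw [mul_add, h₂'] at a2
  have j1 : x₂ * Real.log w₂ ≤ 0.02 * L := by linarith
  have j2 : 0.9 * L ≤ x₁ * Real.log w₁ := by
    have : 0 ≤ x₂ * Real.log (w₂ : ℝ) := by positivity
    linarith
  have pt : (0 : ℝ) < t := by exact_mod_cast h.t_pos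
  have pw1 : (0 : ℝ) < w₁ := by exact_mod_cast h.w_pos
  have pw2 : (0 : ℝ) < w₂ := by exact_mod_cast h.swap.w_pos
  set P : ℤ := (w₁ : ℤ) ^ x₁ with hP
  set Q : ℤ := (w₂ : ℤ) ^ x₂ with hQ
  set W : ℤ := (w₂ : ℤ) ^ k₂ with hW
  have eP : (P : ℝ) = Real.exp (x₁ * Real.log w₁) := by
    rw [hP, ← Real.log_pow, Real.exp_log (by positivity)]; push_cast; rfl
  have eQ : (Q : ℝ) = Real.exp (x₂ * Real.log w₂) := by
    rw [hQ, ← Real.log_pow, Real.exp_log (by positivity)]; push_cast; rfl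
  have eW : (W : ℝ) = Real.exp (k₂ * Real.log w₂) := by
    rw [hW, ← Real.log_pow, Real.exp_log (by positivity)]; push_cast; rfl
  have eT : (t : ℝ) = Real.exp L := by rw [hLdef, Real.exp_log pt]
  have hcross := h.cross_eq
  rw [h.base₁, h.base₂, hk₁, hn₁] at hcross
  have hg2 : (((t ^ n₂ * w₂ : ℕ) : ℤ)) ^ k₂ = (t : ℤ) ^ 2 * W := by
    push_cast
    rw [mul_pow, ← pow_mul, h₂]
  rw [hg2] at hcross
  push_cast at hcross
  rw [← hP, ← hQ, pow_one, pow_one] at hcross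
  set s : ℤ := t * W * Q - w₁ * P with hs
  have es : (t : ℤ) * s = σ₁ * P - σ₂ * Q := by rw [hs]; linear_combination -hcross
  have eN : P * (σ₁ * Q * W - s * w₁) = s ^ 2 + σ₂ * Q ^ 2 * W := by
    linear_combination (-Q * W) * es + s * hs
  have pP : 0 < P := pow_pos (by exact_mod_cast h.w_pos) _
  have pQ : 0 < Q := pow_pos (by exact_mod_cast h.swap.w_pos) _
  have pW : 0 < W := pow_pos (by exact_mod_cast h.swap.w_pos) _
  set E := Real.exp (0.02 * L) with hE
  have bQ : (Q : ℝ) ≤ E := by rw [eQ]; exact Real.exp_le_exp.2 j1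
  have bW : (W : ℝ) ≤ E := by rw [eW]; exact Real.exp_le_exp.2 (by linarith)
  have bP : (P : ℝ) ≤ t * E := by
    rw [eP, eT, ← Real.exp_add]; exact Real.exp_le_exp.2 (by linarith)
  have bP' : E ^ 3 * E ^ 3 ≤ P := by
    rw [eP, hE, ← Real.exp_nat_mul, ← Real.exp_add]
    exact Real.exp_le_exp.2 (by push_cast; linarith)
  have bE : 9 ≤ E := by
    have := Real.add_one_le_exp (0.02 * L)
    linarith
  have rP : (0 : ℝ) < P := by exact_mod_cast pP
  have rQ : (0 : ℝ) < Q := by exact_mod_cast pQ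
  have rW : (0 : ℝ) < W := by exact_mod_cast pW
  have bt : (1 : ℝ) ≤ t := by exact_mod_cast h.t_pos
  have bs : |(s : ℝ)| ≤ 2 * E := by
    have h1 : (t : ℝ) * s = σ₁ * P - σ₂ * Q := by exact_mod_cast es
    have h2 : |(t : ℝ) * s| ≤ P + Q := by
      rw [h1, abs_le]
      rcases h.rep₁.sign with h1 | h1 <;> rcases h.rep₂.sign with h2 | h2 <;> subst h1 <;>
        subst h2 <;> push_cast <;> constructor <;> linarith
    rw [abs_mul, abs_of_pos pt] at h2
    have h3 : (Q : ℝ) ≤ t * E := bQ.trans (le_mul_of_one_le_left (by linarith) bt)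
    exact le_of_mul_le_mul_left (by linarith : t * |(s : ℝ)| ≤ t * (2 * E)) pt
  have bN : |((s ^ 2 + σ₂ * Q ^ 2 * W : ℤ) : ℝ)| < P := by
    have h1 : (s : ℝ) ^ 2 ≤ (2 * E) ^ 2 := by
      rw [← sq_abs]; exact pow_le_pow_left₀ (abs_nonneg _) bs 2
    have h2 : (Q : ℝ) ^ 2 * W ≤ E ^ 2 * E :=
      mul_le_mul (pow_le_pow_left₀ rQ.le bQ 2) bW rW.le (by positivity)
    have h3 : |((s ^ 2 + σ₂ * Q ^ 2 * W : ℤ) : ℝ)| ≤ (s : ℝ) ^ 2 + (Q : ℝ) ^ 2 * W := by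
      have : 0 ≤ (Q : ℝ) ^ 2 * W := by positivity
      have := sq_nonneg (s : ℝ)
      rw [abs_le]
      rcases h.rep₂.sign with h2 | h2 <;> subst h2 <;> push_cast <;> constructor <;> linarith
    have h4 : (E ^ 3 : ℝ) * 9 ≤ E ^ 3 * E ^ 3 := by
      refine mul_le_mul_of_nonneg_left ?_ (by positivity)
      nlinarith [mul_self_nonneg E]
    have h5 : E ^ 2 * 9 ≤ E ^ 2 * E := mul_le_mul_of_nonneg_left bE (by positivity)
    have h6 : 0 < E ^ 3 := by positivity
    linarith
  have hN0 : s ^ 2 + σ₂ * Q ^ 2 * W = 0 := by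
    refine Int.eq_zero_of_abs_lt_dvd (m := P) ⟨_, eN.symm⟩ ?_
    exact_mod_cast bN
  rw [hN0] at eN
  have e0 : σ₁ * Q * W = s * w₁ := by
    have := (mul_eq_zero.1 eN).resolve_left pP.ne'
    linarith
  have hdvd : (w₁ : ℤ) ∣ (w₂ : ℤ) ^ (x₂ + k₂) := by
    refine ⟨s * σ₁, ?_⟩
    rw [pow_add, ← hQ, ← hW]
    rcases h.rep₁.sign with h1 | h1 <;> subst h1 <;> linarith
  have hdvd' : w₁ ∣ w₂ ^ (x₂ + k₂) := by exact_mod_cast hdvd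
  have hw1 : w₁ = 1 := Nat.Coprime.eq_one_of_dvd (h.cop.pow_right _) hdvd'
  rw [hw1, Nat.cast_one, Real.log_one, mul_zero] at j2
  linarith

end RedPair

namespace RedPair

variable {d : ℤ} {g₁ x₁ k₁ : ℕ} {σ₁ : ℤ} {g₂ x₂ k₂ : ℕ} {σ₂ : ℤ} {t w₁ w₂ n₁ n₂ m : ℕ}

/-- The case in which the first exponent is at least `2`. -/
lemma false_of_two_le (h : RedPair d g₁ x₁ k₁ σ₁ g₂ x₂ k₂ σ₂ t w₁ w₂ n₁ n₂ m)
    (hne : x₁ * k₂ ≠ x₂ * k₁) (hx : 2 ≤ x₁) {R S : ℝ}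
    (hR : R = x₁ * Real.log w₁ + x₂ * Real.log w₂ + Real.log m)
    (hS : S = Real.log t + Real.log w₁ + Real.log w₂)
    (h1 : x₁ * Real.log w₁ ≤ S + R / 500) (h2 : x₂ * Real.log w₂ ≤ S + R / 500)
    (h3 : R ≤ S + max (x₁ * Real.log w₁) (x₂ * Real.log w₂) + R / 500) (hR0 : 1000 ≤ R)
    (hy : 100000 ≤ (x₂ : ℝ) + k₂) : False := by
  obtain ⟨u1, u3, u2, -, u5⟩ := h.log_bounds
  obtain ⟨v1, v3, v2, -, v5⟩ := h.swap.log_bounds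
  have hml := h.mul_log_le
  have hmax := max_le h1 h2
  have pL : 0 ≤ Real.log (t : ℝ) := Real.log_natCast_nonneg _
  have pa1 : 0 ≤ Real.log (w₁ : ℝ) := Real.log_natCast_nonneg _
  have pa2 : 0 ≤ Real.log (w₂ : ℝ) := Real.log_natCast_nonneg _
  have px1 : 0 ≤ x₁ * Real.log (w₁ : ℝ) := by positivity
  have px2 : 0 ≤ x₂ * Real.log (w₂ : ℝ) := by positivity
  have pm : 0 ≤ Real.log (m : ℝ) := Real.log_natCast_nonneg _
  have hx' : (2 : ℝ) ≤ x₁ := by exact_mod_cast hx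
  have c3 : (1 : ℝ) ≤ k₁ := by exact_mod_cast h.rep₁.one_le_k
  have i1 := mul_le_mul_of_nonneg_right hx' pa1
  have i2 : R ≤ 4.04 * Real.log g₂ := by linarith
  have hk₂ : (k₂ : ℝ) ≤ 5 := by
    refine le_of_mul_le_mul_right (?_ : _ ≤ 5 * Real.log (g₂ : ℝ)) (by linarith)
    linarith
  have i3 : k₁ * Real.log g₁ ≤ 4.1 * Real.log g₂ := by linarith
  have i4 := mul_le_mul_of_nonneg_right c3 (by linarith : 0 ≤ Real.log (g₁ : ℝ))
  have i5 := mul_le_mul_of_nonneg_right hy (by linarith : 0 ≤ Real.log (g₂ : ℝ))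
  have i6 : Real.log (g₁ : ℝ) ≤ 4.1 * Real.log g₂ := by linarith
  have hx₁ : (10000 : ℝ) ≤ x₁ := by
    have i7 := mul_le_mul_of_nonneg_left i6 (Nat.cast_nonneg (α := ℝ) x₁)
    refine le_of_mul_le_mul_right (?_ : 10000 * Real.log (g₂ : ℝ) ≤ _) (by linarith)
    linarith
  have hx₂ : (10000 : ℝ) ≤ x₂ := by linarith
  have j1 := mul_le_mul_of_nonneg_right hx₁ pa1
  have j2 := mul_le_mul_of_nonneg_right hx₂ pa2
  have hSL : S ≤ 1.0003 * Real.log t := by linarith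
  have hL : 400 ≤ Real.log (t : ℝ) := by linarith
  have key : ∀ {n k : ℕ} {G : ℝ}, (n * k : ℕ) * Real.log (t : ℝ) ≤ k * G →
      k * G ≤ 1.001 * R → n * k ≤ 2 := by
    intro n k G hG1 hG2
    have : ((n * k : ℕ) : ℝ) < 3 := by
      refine lt_of_mul_lt_mul_right (?_ : _ < 3 * Real.log (t : ℝ)) pL
      linarith
    have : n * k < 3 := by exact_mod_cast this
    omega
  have e1 := key u5 (by linarith)
  have e2 := key v5 (by linarith)
  have p1 : 0 < n₁ * k₁ := Nat.mul_pos h.one_le₁ h.rep₁.one_le_k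
  have p2 : 0 < n₂ * k₂ := Nat.mul_pos h.one_le₂ h.rep₂.one_le_k
  rcases (by omega : n₁ * k₁ = n₂ * k₂ ∨ (n₁ * k₁ = 1 ∧ n₂ * k₂ = 2) ∨
    (n₁ * k₁ = 2 ∧ n₂ * k₂ = 1)) with e | ⟨e, e'⟩ | ⟨e, e'⟩
  · exact hne (h.mul_eq_mul_of_exponents_eq e)
  · exact h.false_of_one_two e e' hL (by linarith) (by linarith) (by linarith)
  · exact h.swap.false_of_one_two e' e hL (by linarith) (by linarith) (by linarith)

end RedPair

/-- Away from the exponents `x₁ = k₁ = 1`, two representations with a large exponent have both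
bases equal to `2`. -/
theorem ABCConjecture.eq_two_of_large_exponent (habc : ABCConjecture) :
    ∃ Y : ℕ, ∀ {d : ℤ} {g₁ x₁ k₁ : ℕ} {σ₁ : ℤ} {g₂ x₂ k₂ : ℕ} {σ₂ : ℤ},
      IsRep d g₁ x₁ k₁ σ₁ → IsRep d g₂ x₂ k₂ σ₂ → x₁ * k₂ ≠ x₂ * k₁ →
      ¬ IsPerfectPow g₁ → ¬ IsPerfectPow g₂ → ¬ (x₁ = 1 ∧ k₁ = 1) → Y ≤ x₂ + k₂ →
      g₁ = 2 ∧ g₂ = 2 := by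
  obtain ⟨κ, hκ, hb⟩ := habc.redPair_bounds (ε := 1 / 1000) (by norm_num)
  set R₀ : ℝ := 1000 * κ + 1000 with hR₀
  obtain ⟨Y, hY⟩ := exists_nat_ge (100000 + (4 * (R₀ + 1) ^ 2 + 4 * (R₀ + 3)))
  refine ⟨Y, fun {d g₁ x₁ k₁ σ₁ g₂ x₂ k₂ σ₂} r₁ r₂ hne hp₁ hp₂ hnp hy => ?_⟩
  obtain ⟨t, w₁, w₂, n₁, n₂, m, h⟩ := r₁.exists_redPair r₂
  have hy' : (Y : ℝ) ≤ x₂ + k₂ := by exact_mod_cast hy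
  have hpos : 0 ≤ 4 * (R₀ + 1) ^ 2 + 4 * (R₀ + 3) := by positivity
  rcases le_or_gt (x₁ * Real.log w₁ + x₂ * Real.log w₂ + Real.log m) R₀ with hR | hR
  · exact h.eq_two_of_le hne hp₁ hp₂ hR (by linarith)
  · exfalso
    obtain ⟨b1, b2, b3⟩ := hb _ _ _ _ _ _ _ _ _ _ _ _ _ _ _ h hne _ _ rfl rfl
    set R := x₁ * Real.log w₁ + x₂ * Real.log w₂ + Real.log m with hRdef
    have hx₁ := r₁.one_le_x
    have hk₁ := r₁.one_le_k
    rcases (by omega : 2 ≤ x₁ ∨ (x₁ = 1 ∧ 2 ≤ k₁)) with hx | ⟨hx, hk⟩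
    · exact h.false_of_two_le hne hx hRdef rfl (by linarith) (by linarith) (by linarith)
        (by linarith) (by linarith)
    · exact h.false_of_x_eq_one hx hk hRdef rfl (by linarith) (by linarith) (by linarith)
        (by linarith) (by linarith)

lemma le_two_mul_of_mul_le {G A B : ℝ} (hG : 1 / 2 ≤ G) (hB : 0 ≤ B) (h : A * G ≤ B) :
    A ≤ 2 * B := by
  by_contra! hlt
  have := mul_le_mul hlt.le hG (by norm_num) (by linarith)
  nlinarith

lemma IsRep.neg {d : ℤ} {g g' : ℕ} {σ : ℤ} (h : IsRep d g 1 1 σ) (hg : (g : ℤ) + σ = g')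
    (hg' : 2 ≤ g') : IsRep d g' 1 1 (-σ) := by
  refine ⟨hg', le_rfl, le_rfl, by rcases h.sign with h | h <;> omega, ?_⟩
  rw [← h.eq, ← hg]
  ring

lemma IsRep.half_le_log {d : ℤ} {g x k : ℕ} {σ : ℤ} (h : IsRep d g x k σ) :
    1 / 2 ≤ Real.log (g : ℝ) := by
  linarith [h.log_pos, Real.log_two_gt_d9]

/-- Passing to the other representation `g (g + σ) = g' (g' - σ)`, `g' = g + σ`. -/
lemma RedPair.neg {d : ℤ} {g₁ g' : ℕ} {σ₁ : ℤ} {g₂ x₂ k₂ : ℕ} {σ₂ : ℤ} {t w₁ w₂ n₁ n₂ m : ℕ}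
    (h : RedPair d g₁ 1 1 σ₁ g₂ x₂ k₂ σ₂ t w₁ w₂ n₁ n₂ m) (hn₁ : n₁ = x₂) (hn₂ : n₂ = 1)
    (hg : (g₁ : ℤ) + σ₁ = g') (hg' : 2 ≤ g') :
    RedPair d g' 1 1 (-σ₁) g₂ x₂ k₂ σ₂ w₂ m t n₁ n₂ w₁ := by
  have hb₂ : g₂ = t * w₂ := by rw [h.base₂, hn₂, pow_one]
  have hc := h.rep₂.isCoprime
  rw [h.add₂, pow_one] at hc
  have hc' : Nat.Coprime m g₂ :=
    (Nat.isCoprime_iff_coprime.1 (by exact_mod_cast hc)).coprime_dvd_left (Dvd.intro_left w₁ rfl)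
  refine ⟨h.rep₁.neg hg hg', h.rep₂, h.one_le₁, h.one_le₂, h.coprime_n, h.mul_eq, ?_, ?_, ?_, ?_,
    ?_, h.cop₂.symm, ?_⟩
  · have := h.add₁
    rw [pow_one, hg] at this
    rw [hn₁]
    exact_mod_cast this
  · rw [hn₂, pow_one, hb₂, mul_comm]
  · rw [← hg, h.base₁, hn₁]
    push_cast
    ring
  · rw [h.add₂]
    ring
  · exact (hc'.coprime_dvd_right ⟨t, by rw [hb₂, mul_comm]⟩).symm
  · exact hc'.coprime_dvd_right ⟨w₂, hb₂⟩

lemma ABCConjecture.log_pronic_le (habc : ABCConjecture) {ε : ℝ} (hε : 0 < ε) :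
    ∃ κ : ℝ, 0 ≤ κ ∧ ∀ {d : ℤ} {g₁ : ℕ} {σ₁ : ℤ} {g₂ x k : ℕ} {σ₂ : ℤ},
      IsRep d g₁ 1 1 σ₁ → IsRep d g₂ x k σ₂ →
      Real.log g₁ ≤ κ + 1 + (1 + ε) * (Real.log g₂ + 1 + k * Real.log g₂) ∧
      (x + k) * Real.log g₂ ≤
        κ + (1 + ε) * (7 + Real.log g₂ + x * Real.log g₂ + Real.log g₁) := by
  obtain ⟨κ, hκ, H⟩ := habc.log_le hε
  refine ⟨κ, hκ, fun {d g₁ σ₁ g₂ x k σ₂} h₁ h₂ => ⟨?_, ?_⟩⟩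
  · have hA : (g₁ : ℤ) ^ 1 + σ₁ ≠ 0 := h₁.add_pos.ne'
    have hC : (g₁ : ℤ) ≠ 0 := by have := h₁.two_le; omega
    have hσ : -σ₁ = 1 ∨ -σ₁ = -1 := by rcases h₁.sign with h | h <;> omega
    have h1 := H _ (-σ₁) _ hA (by omega) hC (by ring)
      (Int.isCoprime_iff_gcd_eq_one.1 (by
        rcases hσ with h | h <;> rw [h]
        exacts [isCoprime_one_right, isCoprime_one_right.neg_right]))
    have h2 : lrad (((g₁ : ℤ) ^ 1 + σ₁) * (-σ₁) * g₁) = lrad d := by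
      have h3 := h₁.eq
      rcases hσ with h | h <;> rw [h]
      · congr 1; rw [← h3]; ring
      · rw [← lrad_neg]; congr 1; rw [← h3]; ring
    rw [h2] at h1
    have h4 := (abs_le.1 h₁.abs_log_add).1
    have l2 := Real.log_two_le_one
    have h5 : lrad d ≤ Real.log g₂ + 1 + k * Real.log g₂ := by linarith [h₂.lrad_le]
    have h6 := mul_le_mul_of_nonneg_left h5 (by linarith : 0 ≤ 1 + ε)
    push_cast at h1 h4
    linarith
  · have hg := h₂.two_le
    have hx := h₂.one_le_x
    have pg : (0 : ℝ) < g₂ := by exact_mod_cast (by omega : 0 < g₂)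
    have pg1 : (0 : ℝ) < g₁ := by have := h₁.two_le; exact_mod_cast (by omega : 0 < g₁)
    have h2x := h₂.two_le_pow hx
    have hn : 2 * (g₁ : ℤ) + σ₁ ≠ 0 := by
      have := h₁.two_le
      rcases h₁.sign with h | h <;> omega
    have hB : 4 * σ₂ * (g₂ : ℤ) ^ x + 1 ≠ 0 := by
      rcases h₂.sign with h | h <;> subst h <;> omega
    have hg0 : (g₂ : ℤ) ≠ 0 := by omega
    have hsum : 4 * (g₂ : ℤ) ^ (x + k) + (4 * σ₂ * (g₂ : ℤ) ^ x + 1) = (2 * g₁ + σ₁) ^ 2 := by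
      have h3 := h₁.eq
      have h4 := h₂.eq
      have h5 : σ₁ ^ 2 = 1 := by rcases h₁.sign with h | h <;> rw [h] <;> norm_num
      rw [pow_add]
      linear_combination 4 * h4 - 4 * h3 - h5
    have hcop : IsCoprime (4 * (g₂ : ℤ) ^ (x + k)) (4 * σ₂ * (g₂ : ℤ) ^ x + 1) := by
      refine IsCoprime.mul_left ⟨-(σ₂ * (g₂ : ℤ) ^ x), 1, by ring⟩ (IsCoprime.pow_left ?_)
      obtain ⟨y, rfl⟩ := Nat.exists_eq_add_of_le' hx
      exact ⟨-(4 * σ₂ * (g₂ : ℤ) ^ y), 1, by ring⟩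
    have h1 := H _ _ _ (mul_ne_zero four_ne_zero (pow_ne_zero _ hg0)) hB (pow_ne_zero 2 hn) hsum
      (Int.isCoprime_iff_gcd_eq_one.1 hcop)
    have l2 := Real.log_two_le_one
    have l20 : 0 < Real.log 2 := Real.log_pos one_lt_two
    have e4 : Real.log (4 : ℝ) = 2 * Real.log 2 := by
      rw [show (4 : ℝ) = 2 ^ 2 by norm_num, Real.log_pow]; norm_num
    have e8 : Real.log (8 : ℝ) = 3 * Real.log 2 := by
      rw [show (8 : ℝ) = 2 ^ 3 by norm_num, Real.log_pow]; norm_num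
    have r0 := lrad_mul_three_le (4 * (g₂ : ℤ) ^ (x + k)) (4 * σ₂ * (g₂ : ℤ) ^ x + 1)
      ((2 * g₁ + σ₁) ^ 2)
    have r1 : lrad (4 * (g₂ : ℤ) ^ (x + k)) ≤ 2 + Real.log g₂ := by
      have a1 := lrad_mul_le 4 ((g₂ : ℤ) ^ (x + k))
      have a2 := lrad_pow_natCast_le (by omega : 0 < g₂) (x + k)
      have a3 := lrad_le (n := 4) four_ne_zero
      push_cast at a3
      linarith
    have r2 : lrad (4 * σ₂ * (g₂ : ℤ) ^ x + 1) ≤ 3 + x * Real.log g₂ := by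
      refine (lrad_le hB).trans ?_
      rw [← Real.log_abs]
      have hb : |((4 * σ₂ * (g₂ : ℤ) ^ x + 1 : ℤ) : ℝ)| ≤ 8 * (g₂ : ℝ) ^ x := by
        have : (2 : ℝ) ≤ (g₂ : ℝ) ^ x := by exact_mod_cast h2x
        rw [abs_le]
        rcases h₂.sign with h | h <;> subst h <;> push_cast <;> constructor <;> linarith
      refine (Real.log_le_log (abs_pos.2 (by exact_mod_cast hB)) hb).trans ?_
      rw [Real.log_mul (by norm_num) (by positivity), Real.log_pow]
      linarith
    have r3 : lrad ((2 * (g₁ : ℤ) + σ₁) ^ 2) ≤ 2 + Real.log g₁ := by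
      refine (lrad_pow_le _ 2).trans ((lrad_le hn).trans ?_)
      rw [← Real.log_abs]
      have hb : |((2 * (g₁ : ℤ) + σ₁ : ℤ) : ℝ)| ≤ 4 * (g₁ : ℝ) := by
        have : (2 : ℝ) ≤ (g₁ : ℝ) := by exact_mod_cast h₁.two_le
        rw [abs_le]
        rcases h₁.sign with h | h <;> subst h <;> push_cast <;> constructor <;> linarith
      refine (Real.log_le_log (abs_pos.2 (by exact_mod_cast hn)) hb).trans ?_
      rw [Real.log_mul (by norm_num) (by positivity)]
      linarith
    have r4 := mul_le_mul_of_nonneg_left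
      (by linarith : lrad (4 * (g₂ : ℤ) ^ (x + k) * (4 * σ₂ * (g₂ : ℤ) ^ x + 1) *
        (2 * g₁ + σ₁) ^ 2) ≤ 7 + Real.log g₂ + x * Real.log g₂ + Real.log g₁)
      (by linarith : 0 ≤ 1 + ε)
    push_cast at h1
    rw [Real.log_mul (by norm_num) (by positivity), Real.log_pow] at h1
    push_cast at h1 r4
    linarith

/-- A representation with exponents `x₁ = k₁ = 1` excludes one with a large exponent. -/
theorem ABCConjecture.false_of_pronic (habc : ABCConjecture) :
    ∃ Y : ℕ, ∀ {d : ℤ} {g₁ : ℕ} {σ₁ : ℤ} {g₂ x k : ℕ} {σ₂ : ℤ},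
      IsRep d g₁ 1 1 σ₁ → IsRep d g₂ x k σ₂ → x ≠ k → Y ≤ x + k → False := by
  obtain ⟨κ₁, hκ₁, H₁⟩ := habc.log_pronic_le (ε := 1 / 1000) (by norm_num)
  obtain ⟨κ₂, hκ₂, H₂⟩ := habc.redPair_bounds (ε := 1 / 1000) (by norm_num)
  obtain ⟨Y, hY⟩ := exists_nat_ge (1000 * (κ₁ + κ₂) + 10000)
  refine ⟨Y, fun {d g₁ σ₁ g₂ x k σ₂} r₁ r₂ hne hy => ?_⟩
  obtain ⟨t, w₁, w₂, n₁, n₂, m, h⟩ := r₁.exists_redPair r₂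
  have hy' : (Y : ℝ) ≤ x + k := by exact_mod_cast hy
  have hn₂ : n₂ = 1 := by
    refine Nat.Coprime.eq_one_of_dvd h.coprime_n.symm ⟨x, ?_⟩
    have := h.mul_eq
    rw [one_mul] at this
    rw [this, mul_comm]
  have hn₁ : n₁ = x := by have := h.mul_eq; rw [hn₂] at this; omega
  obtain ⟨p1, p2⟩ := H₁ r₁ r₂
  have hG₂ := r₂.half_le_log
  have hG₁ := r₁.half_le_log
  have l2 := Real.log_two_le_one
  have s1 := abs_le.1 r₁.abs_log
  have s2 := abs_le.1 r₂.abs_log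
  have s3 := abs_le.1 h.abs_log
  have b1 := h.log_base
  have b2 := h.swap.log_base
  rw [hn₁] at b1
  rw [hn₂] at b2
  push_cast at s1 s2 s3 b1 b2
  have py : 10000 * (1 / 2) ≤ ((x : ℝ) + k) * Real.log g₂ :=
    mul_le_mul (by linarith) hG₂ (by norm_num) (by positivity)
  have hg3 : 3 ≤ g₁ := by
    by_contra hlt
    have h2 : g₁ = 2 := by have := r₁.two_le; omega
    rw [h2] at s1
    push_cast at s1
    linarith
  obtain ⟨g', hg'⟩ := Int.eq_ofNat_of_zero_le (by simpa using r₁.add_pos.le : 0 ≤ (g₁ : ℤ) + σ₁)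
  have h' := h.neg hn₁ hn₂ hg' (by rcases r₁.sign with hs | hs <;> omega)
  obtain ⟨-, -, q1⟩ := H₂ _ _ _ _ _ _ _ _ _ _ _ _ _ _ _ h (by omega) _ _ rfl rfl
  obtain ⟨-, -, q2⟩ := H₂ _ _ _ _ _ _ _ _ _ _ _ _ _ _ _ h' (by omega) _ _ rfl rfl
  rw [Nat.cast_one, one_mul] at q1 q2
  have pL : 0 ≤ Real.log (t : ℝ) := Real.log_natCast_nonneg _
  have pa1 : 0 ≤ Real.log (w₁ : ℝ) := Real.log_natCast_nonneg _
  have pa2 : 0 ≤ Real.log (w₂ : ℝ) := Real.log_natCast_nonneg _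
  have pm : 0 ≤ Real.log (m : ℝ) := Real.log_natCast_nonneg _
  have pxL : 0 ≤ x * Real.log (t : ℝ) := by positivity
  have pxa : 0 ≤ x * Real.log (w₂ : ℝ) := by positivity
  have pkG : 0 ≤ k * Real.log (g₂ : ℝ) := by positivity
  have pxG : 0 ≤ x * Real.log (g₂ : ℝ) := by positivity
  have exG : x * Real.log (g₂ : ℝ) = x * Real.log t + x * Real.log w₂ := by rw [b2]; ring
  have P1 : (x : ℝ) ≤ 0.51 * (x + k) + 2 * κ₁ + 20 := by
    have := le_two_mul_of_mul_le (G := Real.log g₂) (A := x - 0.51 * (x + k) - 2) (B := κ₁ + 5)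
      hG₂ (by linarith) (by linarith)
    linarith
  have P2 : 0.49 * ((x : ℝ) + k) ≤ x + 2 * κ₁ + 30 := by
    have := le_two_mul_of_mul_le (G := Real.log g₂) (A := 0.49 * (x + k) - x - 2) (B := κ₁ + 10)
      hG₂ (by linarith) (by linarith)
    linarith
  rcases max_cases (Real.log (w₁ : ℝ)) (x * Real.log (w₂ : ℝ)) with ⟨e1, -⟩ | ⟨e1, -⟩ <;>
    rcases max_cases (Real.log (m : ℝ)) (x * Real.log (t : ℝ)) with ⟨e2, -⟩ | ⟨e2, -⟩ <;>
    rw [e1] at q1 <;> rw [e2] at q2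
  · have := le_two_mul_of_mul_le (G := Real.log g₂) (A := x - 0.01 * (x + k) - 3)
      (B := 2 * κ₂ + 20) hG₂ (by linarith) (by linarith)
    linarith
  · have := le_two_mul_of_mul_le (G := Real.log g₂) (A := 0.4 * (x + k) - 3)
      (B := 2 * κ₂ + 20) hG₂ (by linarith) (by linarith)
    linarith
  · have := le_two_mul_of_mul_le (G := Real.log g₂) (A := 0.4 * (x + k) - 3)
      (B := 2 * κ₂ + 20) hG₂ (by linarith) (by linarith)
    linarith
  · have := le_two_mul_of_mul_le (G := Real.log g₂) (A := 0.9 * (x + k) - x - 3)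
      (B := 2 * κ₂ + 20) hG₂ (by linarith) (by linarith)
    linarith

/-- Two representations of a large number with different ratios of exponents have bases `2`. -/
theorem ABCConjecture.eq_two (habc : ABCConjecture) :
    ∃ D : ℕ, ∀ {d : ℤ} {g₁ x₁ k₁ : ℕ} {σ₁ : ℤ} {g₂ x₂ k₂ : ℕ} {σ₂ : ℤ}, (D : ℤ) ≤ d →
      IsRep d g₁ x₁ k₁ σ₁ → IsRep d g₂ x₂ k₂ σ₂ → x₁ * k₂ ≠ x₂ * k₁ →
      ¬ IsPerfectPow g₁ → ¬ IsPerfectPow g₂ → g₁ = 2 ∧ g₂ = 2 := by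
  obtain ⟨Y₁, hY₁⟩ := habc.eq_two_of_large_exponent
  obtain ⟨Y₂, hY₂⟩ := habc.false_of_pronic
  set Y := max Y₁ Y₂ with hY
  have hf : ∀ v : (ℕ × ℕ) × ℕ × ℕ, ∃ B : ℝ, v.1.1 * v.2.2 ≠ v.2.1 * v.1.2 →
      ∀ d g₁ g₂ σ₁ σ₂, IsRep d g₁ v.1.1 v.1.2 σ₁ → IsRep d g₂ v.2.1 v.2.2 σ₂ →
        Real.log d ≤ B := by
    intro v
    by_cases hv : v.1.1 * v.2.2 = v.2.1 * v.1.2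
    · exact ⟨0, fun h => absurd hv h⟩
    · obtain ⟨B, hB⟩ := habc.fixed_exponents hv
      exact ⟨B, fun _ => hB⟩
  choose f hf using hf
  obtain ⟨B, hB⟩ := Finset.exists_le
    (((Finset.range Y ×ˢ Finset.range Y) ×ˢ (Finset.range Y ×ˢ Finset.range Y)).image f)
  obtain ⟨D, hD⟩ := exists_nat_gt (Real.exp B)
  refine ⟨D, fun {d g₁ x₁ k₁ σ₁ g₂ x₂ k₂ σ₂} hd r₁ r₂ hne hp₁ hp₂ => ?_⟩
  have key : ∀ {g₁ x₁ k₁ : ℕ} {σ₁ : ℤ} {g₂ x₂ k₂ : ℕ} {σ₂ : ℤ},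
      IsRep d g₁ x₁ k₁ σ₁ → IsRep d g₂ x₂ k₂ σ₂ → x₁ * k₂ ≠ x₂ * k₁ →
      ¬ IsPerfectPow g₁ → ¬ IsPerfectPow g₂ → Y ≤ x₂ + k₂ → g₁ = 2 ∧ g₂ = 2 := by
    intro g₁ x₁ k₁ σ₁ g₂ x₂ k₂ σ₂ r₁ r₂ hne hp₁ hp₂ hy
    by_cases hpr : x₁ = 1 ∧ k₁ = 1
    · obtain ⟨rfl, rfl⟩ := hpr
      exact (hY₂ r₁ r₂ (by omega) (by omega)).elim
    · exact hY₁ r₁ r₂ hne hp₁ hp₂ hpr (by omega)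
  by_cases h₂ : Y ≤ x₂ + k₂
  · exact key r₁ r₂ hne hp₁ hp₂ h₂
  by_cases h₁ : Y ≤ x₁ + k₁
  · exact (key r₂ r₁ hne.symm hp₂ hp₁ h₁).symm
  exfalso
  have hlog := hf ((x₁, k₁), (x₂, k₂)) hne d g₁ g₂ σ₁ σ₂ r₁ r₂
  have hle := hB (f ((x₁, k₁), (x₂, k₂))) (Finset.mem_image_of_mem f (by simp; omega))
  have hd0 : (0 : ℝ) < d := by exact_mod_cast r₁.pos
  have hdD : (D : ℝ) ≤ d := by exact_mod_cast hd
  have := (Real.log_le_iff_le_exp hd0).1 (hlog.trans hle)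
  linarith

lemma IsRep.le_of_mul_eq_mul {d : ℤ} {g₁ x₁ k₁ g₂ x₂ k₂ : ℕ} {σ : ℤ} (r₁ : IsRep d g₁ x₁ k₁ σ)
    (r₂ : IsRep d g₂ x₂ k₂ σ) (h : x₁ * k₂ = x₂ * k₁) : g₁ ^ (x₁ + k₁) ≤ g₂ ^ (x₂ + k₂) := by
  by_contra! hlt
  have hx₁ := r₁.one_le_x
  have hx₂ := r₂.one_le_x
  have hk₁ := r₁.one_le_k
  have hx : g₂ ^ x₂ < g₁ ^ x₁ := by
    refine lt_of_pow_lt_pow_left₀ (x₁ + k₁) (by positivity) ?_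
    calc (g₂ ^ x₂) ^ (x₁ + k₁) = (g₂ ^ (x₂ + k₂)) ^ x₁ := by
          rw [← pow_mul, ← pow_mul]; congr 1; linarith
      _ < (g₁ ^ (x₁ + k₁)) ^ x₁ := Nat.pow_lt_pow_left hlt (by omega)
      _ = (g₁ ^ x₁) ^ (x₁ + k₁) := by rw [← pow_mul, ← pow_mul]; congr 1; ring
  have hk : g₂ ^ k₂ < g₁ ^ k₁ := by
    refine lt_of_pow_lt_pow_left₀ (x₁ + k₁) (by positivity) ?_
    calc (g₂ ^ k₂) ^ (x₁ + k₁) = (g₂ ^ (x₂ + k₂)) ^ k₁ := by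
          rw [← pow_mul, ← pow_mul]; congr 1; linarith
      _ < (g₁ ^ (x₁ + k₁)) ^ k₁ := Nat.pow_lt_pow_left hlt (by omega)
      _ = (g₁ ^ k₁) ^ (x₁ + k₁) := by rw [← pow_mul, ← pow_mul]; congr 1; ring
  have hx' : (g₂ : ℤ) ^ x₂ < (g₁ : ℤ) ^ x₁ := by exact_mod_cast hx
  have hk' : (g₂ : ℤ) ^ k₂ < (g₁ : ℤ) ^ k₁ := by exact_mod_cast hk
  have := mul_lt_mul'' hx' (add_lt_add_left hk' σ) (by positivity) r₂.add_pos.le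
  have e1 := r₁.eq
  have e2 := r₂.eq
  linarith

lemma IsRep.le_of_two {d : ℤ} {x₁ k₁ x₂ k₂ : ℕ} {σ₁ σ₂ : ℤ} (r₁ : IsRep d 2 x₁ k₁ σ₁)
    (r₂ : IsRep d 2 x₂ k₂ σ₂) : x₁ ≤ x₂ := by
  have hc : IsCoprime ((2 : ℤ) ^ x₁) ((2 : ℤ) ^ k₂ + σ₂) := by
    have := r₂.isCoprime.symm.pow_left (m := x₁)
    exact_mod_cast this
  have hdvd : (2 : ℤ) ^ x₁ ∣ (2 : ℤ) ^ x₂ * ((2 : ℤ) ^ k₂ + σ₂) := by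
    have e1 := r₁.eq
    have e2 := r₂.eq
    push_cast at e1 e2
    rw [e2, ← e1]
    exact dvd_mul_right _ _
  have := hc.dvd_of_dvd_mul_right hdvd
  exact (Nat.pow_dvd_pow_iff_le_right (by norm_num : 1 < 2)).1 (by exact_mod_cast this)

/-- The larger of the two powers in a representation of a large number is determined by the
sign. -/
theorem ABCConjecture.pow_eq_pow (habc : ABCConjecture) :
    ∃ D : ℕ, ∀ {d : ℤ} {g₁ x₁ k₁ g₂ x₂ k₂ : ℕ} {σ : ℤ}, (D : ℤ) ≤ d →
      IsRep d g₁ x₁ k₁ σ → IsRep d g₂ x₂ k₂ σ → ¬ IsPerfectPow g₁ → ¬ IsPerfectPow g₂ →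
      g₁ ^ (x₁ + k₁) = g₂ ^ (x₂ + k₂) := by
  obtain ⟨D, hD⟩ := habc.eq_two
  refine ⟨D, fun {d g₁ x₁ k₁ g₂ x₂ k₂ σ} hd r₁ r₂ hp₁ hp₂ => ?_⟩
  by_cases h : x₁ * k₂ = x₂ * k₁
  · exact le_antisymm (r₁.le_of_mul_eq_mul r₂ h) (r₂.le_of_mul_eq_mul r₁ h.symm)
  · obtain ⟨rfl, rfl⟩ := hD hd r₁ r₂ h hp₁ hp₂
    obtain rfl : x₁ = x₂ := le_antisymm (r₁.le_of_two r₂) (r₂.le_of_two r₁)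
    have h1 := mul_left_cancel₀ (by positivity) (r₁.eq.trans r₂.eq.symm)
    have h2 := add_right_cancel h1
    rw [pow_add, pow_add]
    congr 1
    exact_mod_cast h2

lemma exists_eq_pow_not_isPerfectPow (n : ℕ) (hn : 2 ≤ n) :
    ∃ g e : ℕ, 2 ≤ g ∧ 1 ≤ e ∧ ¬ IsPerfectPow g ∧ n = g ^ e := by
  induction n using Nat.strong_induction_on with
  | _ n ih =>
    by_cases h : IsPerfectPow n
    · obtain ⟨a, k, ha, hk, rfl⟩ := h
      obtain ⟨g, e, hg, he, hp, rfl⟩ := ih a (lt_self_pow₀ (by omega) (by omega)) ha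
      exact ⟨g, e * k, hg, Nat.mul_pos he (by omega), hp, by rw [pow_mul]⟩
    · exact ⟨n, 1, hn, le_rfl, h, by rw [pow_one]⟩

lemma MultDepPair.exists_natAbs_eq_pow {a b : ℤ} (h : MultDepPair a b) (ha : 2 ≤ a.natAbs)
    (hb : 2 ≤ b.natAbs) : ∃ g i j : ℕ, 2 ≤ g ∧ ¬ IsPerfectPow g ∧ 1 ≤ i ∧ 1 ≤ j ∧
      a.natAbs = g ^ i ∧ b.natAbs = g ^ j := by
  obtain ⟨hab, ⟨k, l⟩, hkl, heq⟩ := h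
  simp only at heq
  have hla : 0 < Real.log (a.natAbs : ℝ) := Real.log_pos (by exact_mod_cast ha)
  have hlb : 0 < Real.log (b.natAbs : ℝ) := Real.log_pos (by exact_mod_cast hb)
  have hlog : (k : ℝ) * Real.log (a.natAbs : ℝ) + l * Real.log (b.natAbs : ℝ) = 0 := by
    have h1 : (a : ℝ) ^ k * (b : ℝ) ^ l = 1 := by
      have := congrArg (Rat.cast : ℚ → ℝ) heq
      push_cast at this
      exact this
    have ha0 : (a : ℝ) ≠ 0 := by exact_mod_cast left_ne_zero_of_mul hab
    have hb0 : (b : ℝ) ≠ 0 := by exact_mod_cast right_ne_zero_of_mul hab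
    have h2 := congrArg Real.log h1
    rwa [Real.log_mul (zpow_ne_zero _ ha0) (zpow_ne_zero _ hb0), Real.log_zpow, Real.log_zpow,
      Real.log_one, ← log_natAbs, ← log_natAbs] at h2
  have hk : k ≠ 0 := by
    rintro rfl
    rw [Int.cast_zero, zero_mul, zero_add] at hlog
    have : (l : ℝ) = 0 := (mul_eq_zero.1 hlog).resolve_right hlb.ne'
    exact hkl (by rw [Int.cast_eq_zero.1 this]; rfl)
  have hl : l ≠ 0 := by
    rintro rfl
    rw [Int.cast_zero, zero_mul, add_zero] at hlog
    have : (k : ℝ) = 0 := (mul_eq_zero.1 hlog).resolve_right hla.ne'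
    exact hkl (by rw [Int.cast_eq_zero.1 this]; rfl)
  have habs : (k.natAbs : ℝ) * Real.log (a.natAbs : ℝ) = l.natAbs * Real.log (b.natAbs : ℝ) := by
    have h1 := congrArg abs (eq_neg_of_add_eq_zero_left hlog)
    rw [abs_neg, abs_mul, abs_mul, abs_of_pos hla, abs_of_pos hlb] at h1
    have hcast : ∀ z : ℤ, (z.natAbs : ℝ) = |(z : ℝ)| := fun z => by
      rw [Nat.cast_natAbs, Int.cast_abs]
    rwa [hcast k, hcast l]
  have hpow : a.natAbs ^ k.natAbs = b.natAbs ^ l.natAbs := by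
    rw [← Real.log_pow, ← Real.log_pow] at habs
    have := Real.log_injOn_pos (Set.mem_Ioi.2 (by positivity)) (Set.mem_Ioi.2 (by positivity)) habs
    exact_mod_cast this
  have hk' : 0 < k.natAbs := Int.natAbs_pos.2 hk
  have hl' : 0 < l.natAbs := Int.natAbs_pos.2 hl
  obtain ⟨c, hc₁, hc₂⟩ := Nat.exists_eq_pow_of_pow_eq_pow (Or.inl hk'.ne') hpow
  have hG : 0 < Nat.gcd k.natAbs l.natAbs := Nat.gcd_pos_of_pos_left _ hk'
  have hu : 1 ≤ l.natAbs / Nat.gcd k.natAbs l.natAbs :=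
    (Nat.one_le_div_iff hG).2 (Nat.le_of_dvd hl' (Nat.gcd_dvd_right _ _))
  have hv : 1 ≤ k.natAbs / Nat.gcd k.natAbs l.natAbs :=
    (Nat.one_le_div_iff hG).2 (Nat.le_of_dvd hk' (Nat.gcd_dvd_left _ _))
  have hc : 2 ≤ c := by
    by_contra hlt
    have := Nat.pow_le_pow_left (by omega : c ≤ 1) (l.natAbs / Nat.gcd k.natAbs l.natAbs)
    rw [one_pow, ← hc₁] at this
    omega
  obtain ⟨g, e, hg, he, hp, rfl⟩ := exists_eq_pow_not_isPerfectPow c hc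
  exact ⟨g, _, _, hg, hp, Nat.mul_pos he hu, Nat.mul_pos he hv, by rw [hc₁, pow_mul],
    by rw [hc₂, pow_mul]⟩

lemma isRep_of_lt {d : ℤ} {g i j : ℕ} {σ : ℤ} (hg : 2 ≤ g) (hi : 1 ≤ i) (hij : i < j)
    (hσ : σ = 1 ∨ σ = -1) (h : (g : ℤ) ^ j + σ * (g : ℤ) ^ i = d) : IsRep d g i (j - i) σ := by
  refine ⟨hg, hi, by omega, hσ, ?_⟩
  rw [mul_add, ← pow_add, Nat.add_sub_cancel' hij.le, ← h]
  ring

/-- A nontrivial multiplicatively dependent pair with difference `d` comes from a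
representation of `d`. -/
lemma MultDepPair.exists_isRep {a b : ℤ} (h : MultDepPair a b) (ha : 2 ≤ a.natAbs)
    (hb : 2 ≤ b.natAbs) (hab : a.natAbs ≠ b.natAbs) (hlt : a < b) :
    ∃ (g x k : ℕ) (σ : ℤ), IsRep (b - a) g x k σ ∧ ¬ IsPerfectPow g ∧
      (b = (g : ℤ) ^ (x + k) ∨ -a = (g : ℤ) ^ (x + k)) := by
  obtain ⟨g, i, j, hg, hp, hi, hj, hai, hbj⟩ := h.exists_natAbs_eq_pow ha hb
  have hai' : (a.natAbs : ℤ) = (g : ℤ) ^ i := by exact_mod_cast hai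
  have hbj' : (b.natAbs : ℤ) = (g : ℤ) ^ j := by exact_mod_cast hbj
  have hij : i ≠ j := by rintro rfl; exact hab (hai.trans hbj.symm)
  rcases hij.lt_or_gt with hij | hij
  · have hpow : g ^ i < g ^ j := Nat.pow_lt_pow_right (by omega) hij
    rcases le_or_gt a 0 with h0 | h0
    · exact ⟨g, i, j - i, 1, isRep_of_lt hg hi hij (Or.inl rfl) (by omega), hp,
        Or.inl (by rw [Nat.add_sub_cancel' hij.le]; omega)⟩
    · exact ⟨g, i, j - i, -1, isRep_of_lt hg hi hij (Or.inr rfl) (by omega), hp,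
        Or.inl (by rw [Nat.add_sub_cancel' hij.le]; omega)⟩
  · have hpow : g ^ j < g ^ i := Nat.pow_lt_pow_right (by omega) hij
    rcases le_or_gt b 0 with h0 | h0
    · exact ⟨g, j, i - j, -1, isRep_of_lt hg hj hij (Or.inr rfl) (by omega), hp,
        Or.inr (by rw [Nat.add_sub_cancel' hij.le]; omega)⟩
    · exact ⟨g, j, i - j, 1, isRep_of_lt hg hj hij (Or.inl rfl) (by omega), hp,
        Or.inr (by rw [Nat.add_sub_cancel' hij.le]; omega)⟩

theorem stmt18 (habc : ABCConjecture) :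
    ∃ D : ℕ, ∀ d : ℕ, D ≤ d → M (d : ℤ) ≤ 9 := by
  obtain ⟨D, hD⟩ := habc.pow_eq_pow
  refine ⟨D + 1, fun d hd => ?_⟩
  have hA : ∀ σ : ℤ, ∃ A : ℤ, ∀ {g x k : ℕ}, IsRep d g x k σ → ¬ IsPerfectPow g →
      (g : ℤ) ^ (x + k) = A := by
    intro σ
    by_cases hex : ∃ g x k : ℕ, IsRep d g x k σ ∧ ¬ IsPerfectPow g
    · obtain ⟨g₀, x₀, k₀, r₀, hp₀⟩ := hex
      refine ⟨(g₀ : ℤ) ^ (x₀ + k₀), fun r hp => ?_⟩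
      exact_mod_cast hD (by exact_mod_cast (by omega : D ≤ d)) r r₀ hp hp₀
    · exact ⟨0, fun r hp => (hex ⟨_, _, _, r, hp⟩).elim⟩
  obtain ⟨A, hA₁⟩ := hA 1
  obtain ⟨B, hB₁⟩ := hA (-1)
  set s : List (ℤ × ℤ) := [(1, 1 + (d : ℤ)), (-1, (d : ℤ) - 1), (1 - (d : ℤ), 1),
    (-1 - (d : ℤ), -1), (-((d : ℤ) / 2), (d : ℤ) / 2), (A - d, A), (-A, d - A), (B - d, B),
    (-B, d - B)] with hs
  have hsub : MSet d ⊆ s.toFinset := by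
    rintro ⟨a, b⟩ ⟨hdep, hdiff⟩
    simp only at hdep hdiff
    simp only [hs, List.coe_toFinset, Set.mem_ofPred_eq, List.mem_cons, Prod.mk.injEq]
    have ha0 := left_ne_zero_of_mul hdep.1
    have hb0 := right_ne_zero_of_mul hdep.1
    by_cases ha : 2 ≤ a.natAbs
    swap
    · rcases (by omega : a = 1 ∧ b = 1 + d ∨ a = -1 ∧ b = d - 1) with h | h <;>
        simp only [h, true_or, or_true, and_self]
    by_cases hb : 2 ≤ b.natAbs
    swap
    · rcases (by omega : a = 1 - d ∧ b = 1 ∨ a = -1 - d ∧ b = -1) with h | h <;>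
        simp only [h, true_or, or_true, and_self]
    by_cases hab : a.natAbs = b.natAbs
    · have h : a = -((d : ℤ) / 2) ∧ b = (d : ℤ) / 2 := by omega
      simp only [h, true_or, or_true, and_self]
    obtain ⟨g, x, k, σ, r, hp, h⟩ := hdep.exists_isRep ha hb hab (by omega)
    rw [hdiff] at r
    rcases r.sign with rfl | rfl
    · rw [hA₁ r hp] at h
      rcases (by omega : a = A - d ∧ b = A ∨ a = -A ∧ b = d - A) with h | h <;>
        simp only [h, true_or, or_true, and_self]
    · rw [hB₁ r hp] at h
      rcases (by omega : a = B - d ∧ b = B ∨ a = -B ∧ b = d - B) with h | h <;>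
        simp only [h, true_or, or_true, and_self]
  calc M d ≤ (s.toFinset : Set (ℤ × ℤ)).ncard := Set.ncard_le_ncard hsub (Finset.finite_toSet _)
    _ = s.toFinset.card := Set.ncard_coe_finset _
    _ ≤ 9 := List.toFinset_card_le _
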